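/- arXiv:1602.05173 — 6 statements merged into one kernel-verified Lean document; each statement's English description precedes it below -/
import Mathlib

section
/- Let M be an L-structure, A ⊆ M, and suppose M is strongly homogeneous over A. Let p and q be complete types over A. If there exists a correspondence over A between p(M) and q(M) and p is measurable over A, then q is measurable over A, and p(M) and q(M) are commensurable over A. -/
open FirstOrder Set

namespace Unimod

universe u v w

variable (L : FirstOrder.Language.{u, v}) {M : Type w} [L.Structure M]

/-- Two tuples (indexed by `α`) satisfy the same `L`-formulas with parameters from `A`,
i.e. they have the same complete type over `A`. -/
def SameType (A : Set M) {α : Type*} (a b : α → M) : Prop :=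
  ∀ φ : L.Formula (↥A ⊕ α),
    φ.Realize (Sum.elim (fun x => (x : M)) a) ↔ φ.Realize (Sum.elim (fun x => (x : M)) b)

/-- The set of realizations of the complete type of the tuple `a` over `A`. -/
def typeSet (A : Set M) {α : Type*} (a : α → M) : Set (α → M) :=
  {b | SameType L A a b}

/-- A set is type-definable over `A` if it is an intersection of a family of `A`-definable
sets. -/
def TypeDefinable (A : Set M) {α : Type*} (s : Set (α → M)) : Prop :=
  ∃ S : Set (Set (α → M)), (∀ t ∈ S, A.Definable L t) ∧ s = ⋂₀ S

/-- View a set of pairs of tuples as a set of `Fin n ⊕ Fin m`-indexed tuples. -/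
def pairSet {M : Type w} {n m : ℕ} (C : Set ((Fin n → M) × (Fin m → M))) :
    Set ((Fin n ⊕ Fin m) → M) :=
  {v | (v ∘ Sum.inl, v ∘ Sum.inr) ∈ C}

/-- A correspondence over `A` between `X ⊆ M^n` and `Y ⊆ M^m`: a nonempty subset of `X × Y`,
type-definable over `A`, all of whose fibres and cofibres are finite. -/
structure IsCorrespondence (A : Set M) {n m : ℕ} (X : Set (Fin n → M)) (Y : Set (Fin m → M))
    (C : Set ((Fin n → M) × (Fin m → M))) : Prop where
  nonempty : C.Nonempty
  subset : C ⊆ X ×ˢ Y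
  typeDefinable : TypeDefinable L A (pairSet C)
  finite_fibers : ∀ x ∈ X, {y | (x, y) ∈ C}.Finite
  finite_cofibers : ∀ y ∈ Y, {x | (x, y) ∈ C}.Finite

/-- A uniform correspondence over `A` with constant fibre size `k` and cofibre size `ℓ`. -/
structure IsUniformCorrespondence (A : Set M) {n m : ℕ} (X : Set (Fin n → M))
    (Y : Set (Fin m → M)) (C : Set ((Fin n → M) × (Fin m → M))) (k ℓ : ℕ)
    extends IsCorrespondence L A X Y C : Prop where
  k_pos : 0 < k
  l_pos : 0 < ℓ
  fiber_card : ∀ x ∈ X, {y | (x, y) ∈ C}.ncard = k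
  cofiber_card : ∀ y ∈ Y, {x | (x, y) ∈ C}.ncard = ℓ

/-- A type-definable set `X` is measurable over `A` if every uniform correspondence over `A`
between `X` and itself is balanced. -/
def MeasurableOver (A : Set M) {n : ℕ} (X : Set (Fin n → M)) : Prop :=
  ∀ (C : Set ((Fin n → M) × (Fin n → M))) (k ℓ : ℕ),
    IsUniformCorrespondence L A X X C k ℓ → k = ℓ

/-- `X` and `Y` are commensurable over `A`, with common ratio `r`. -/
def CommensurableOverWithRatio (A : Set M) {n m : ℕ} (X : Set (Fin n → M))
    (Y : Set (Fin m → M)) (r : ℚ) : Prop :=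
  (∃ C k ℓ, IsUniformCorrespondence L A X Y C k ℓ) ∧
    ∀ C k ℓ, IsUniformCorrespondence L A X Y C k ℓ → (k : ℚ) / (ℓ : ℚ) = r

/-- `X` and `Y` are commensurable over `A`: there is a uniform correspondence over `A` between
them, and all such have the same ratio. -/
def CommensurableOver (A : Set M) {n m : ℕ} (X : Set (Fin n → M)) (Y : Set (Fin m → M)) : Prop :=
  ∃ r : ℚ, CommensurableOverWithRatio L A X Y r

/-- `M` is strongly homogeneous over `A`: any two tuples with the same type over `A` are
conjugate by an automorphism of `M` fixing `A` pointwise. -/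
def StronglyHomogeneousOver (A : Set M) : Prop :=
  ∀ (n : ℕ) (a b : Fin n → M), SameType L A a b →
    ∃ σ : M ≃[L] M, (∀ x ∈ A, σ x = x) ∧ ∀ i, σ (a i) = b i

/-- `M` is unimodular (with respect to the cardinal bound `κ` on parameter sets):
whenever `a ≡_A b` are interalgebraic over `A`, then `m(a/A ∪ b) = m(b/A ∪ a)`. -/
def Unimodular (κ : Cardinal.{w}) : Prop :=
  ∀ A : Set M, Cardinal.mk A < κ → ∀ (n : ℕ) (a b : Fin n → M),
    SameType L A a b →
    (typeSet L (A ∪ Set.range b) a).Finite →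
    (typeSet L (A ∪ Set.range a) b).Finite →
    (typeSet L (A ∪ Set.range b) a).ncard = (typeSet L (A ∪ Set.range a) b).ncard

/-- `M` is `κ`-saturated: every finitely satisfiable set of formulas in finitely many free
variables with parameters from a set of size `< κ` is realized in `M`. -/
def Saturated (κ : Cardinal.{w}) : Prop :=
  ∀ A : Set M, Cardinal.mk A < κ →
    ∀ (n : ℕ) (T : Set (L.Formula (↥A ⊕ Fin n))),
      (∀ T₀ : Finset (L.Formula (↥A ⊕ Fin n)), ↑T₀ ⊆ T →
        ∃ v : Fin n → M, ∀ φ ∈ T₀, φ.Realize (Sum.elim (fun x => (x : M)) v)) →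
      ∃ v : Fin n → M, ∀ φ ∈ T, φ.Realize (Sum.elim (fun x => (x : M)) v)

/-- A function `f : X → Y` is relatively definable over `A` if its graph is the intersection
of an `A`-definable set with `X × Y`. -/
def RelativelyDefinableFn (A : Set M) {n m : ℕ} (X : Set (Fin n → M)) (Y : Set (Fin m → M))
    (f : (Fin n → M) → (Fin m → M)) : Prop :=
  ∃ D : Set ((Fin n ⊕ Fin m) → M), A.Definable L D ∧
    ∀ x ∈ X, ∀ y ∈ Y, (Sum.elim x y ∈ D ↔ f x = y)

/-- The `≡_A`-class of the pair `c`. -/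
def pairClass (A : Set M) {n m : ℕ} (c : (Fin n → M) × (Fin m → M)) :
    Set ((Fin n → M) × (Fin m → M)) :=
  {p | SameType L A (Sum.elim c.1 c.2) (Sum.elim p.1 p.2)}

/-- A complete correspondence over `A`: a correspondence which is a single `≡_A`-class. -/
def IsCompleteCorrespondence (A : Set M) {n m : ℕ} (X : Set (Fin n → M)) (Y : Set (Fin m → M))
    (C : Set ((Fin n → M) × (Fin m → M))) : Prop :=
  IsCorrespondence L A X Y C ∧ ∃ c ∈ C, C = pairClass L A c

section Automorphisms

variable {L}

theorem SameType.symm {A : Set M} {α : Type*} {a b : α → M} (h : SameType L A a b) :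
    SameType L A b a :=
  fun φ => (h φ).symm

theorem SameType.trans {A : Set M} {α : Type*} {a b c : α → M} (h : SameType L A a b)
    (h' : SameType L A b c) : SameType L A a c :=
  fun φ => (h φ).trans (h' φ)

theorem sameType_comp_equiv {A : Set M} {α : Type*} (σ : M ≃[L] M) (hσ : ∀ x ∈ A, σ x = x)
    (a : α → M) : SameType L A a (σ ∘ a) := by
  intro φ
  rw [← Language.StrongHomClass.realize_formula σ φ, Sum.comp_elim]
  have : (σ ∘ fun x : A => (x : M)) = fun x : A => (x : M) := funext fun x => hσ x x.2
  rw [this]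

theorem comp_mem_typeSet {A : Set M} {α : Type*} {a x : α → M} (σ : M ≃[L] M)
    (hσ : ∀ x ∈ A, σ x = x) (hx : x ∈ typeSet L A a) : σ ∘ x ∈ typeSet L A a :=
  SameType.trans hx (sameType_comp_equiv σ hσ x)

theorem StronglyHomogeneousOver.exists_equiv {A : Set M} (h : StronglyHomogeneousOver L A)
    {n : ℕ} {a x y : Fin n → M} (hx : x ∈ typeSet L A a) (hy : y ∈ typeSet L A a) :
    ∃ σ : M ≃[L] M, (∀ z ∈ A, σ z = z) ∧ σ ∘ x = y := by
  obtain ⟨σ, hσ, hxy⟩ := h n x y (SameType.trans (SameType.symm hx) hy)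
  exact ⟨σ, hσ, funext hxy⟩

/-- Sets definable over `A` are invariant under automorphisms fixing `A`. -/
theorem mem_comp_equiv_of_definable {A : Set M} {α : Type*} {s : Set (α → M)}
    (hs : A.Definable L s) (σ : M ≃[L] M) (hσ : ∀ x ∈ A, σ x = x) (v : α → M) :
    σ ∘ v ∈ s ↔ v ∈ s := by
  obtain ⟨φ, rfl⟩ := definable_iff_exists_formula_sum.1 hs
  exact (sameType_comp_equiv σ hσ v φ).symm

theorem TypeDefinable.mem_comp_equiv {A : Set M} {α : Type*} {s : Set (α → M)}
    (hs : TypeDefinable L A s) (σ : M ≃[L] M) (hσ : ∀ x ∈ A, σ x = x) (v : α → M) :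
    σ ∘ v ∈ s ↔ v ∈ s := by
  obtain ⟨S, hS, rfl⟩ := hs
  simp only [mem_sInter]
  exact forall₂_congr fun t ht => mem_comp_equiv_of_definable (hS t ht) σ hσ v

theorem typeDefinable_of_forall_notMem {A : Set M} {α : Type*} {s : Set (α → M)}
    (h : ∀ v ∉ s, ∃ t, A.Definable L t ∧ s ⊆ t ∧ v ∉ t) : TypeDefinable L A s := by
  refine ⟨{t | A.Definable L t ∧ s ⊆ t}, fun t ht => ht.1,
    Subset.antisymm (subset_sInter fun t ht => ht.2) fun v hv => ?_⟩
  by_contra hvs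
  obtain ⟨t, ht, hst, hvt⟩ := h v hvs
  exact hvt (hv t ⟨ht, hst⟩)

/-- A set of pairs is invariant over `A` if it is preserved by automorphisms fixing `A`. -/
def IsInvariant (L : FirstOrder.Language.{u, v}) [L.Structure M] (A : Set M) {n m : ℕ}
    (C : Set ((Fin n → M) × (Fin m → M))) : Prop :=
  ∀ σ : M ≃[L] M, (∀ x ∈ A, σ x = x) → ∀ x y, (σ ∘ x, σ ∘ y) ∈ C ↔ (x, y) ∈ C

theorem isInvariant_of_typeDefinable {A : Set M} {n m : ℕ}
    {C : Set ((Fin n → M) × (Fin m → M))} (h : TypeDefinable L A (pairSet C)) :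
    IsInvariant L A C :=
  fun σ hσ x y => h.mem_comp_equiv σ hσ (Sum.elim x y)

theorem StronglyHomogeneousOver.exists_equiv_pair {A : Set M} (h : StronglyHomogeneousOver L A)
    {n m : ℕ} {a b : Fin n ⊕ Fin m → M} (hab : SameType L A a b) :
    ∃ σ : M ≃[L] M, (∀ z ∈ A, σ z = z) ∧ σ ∘ a = b := by
  obtain ⟨σ, hσ, hab'⟩ := h (n + m) (a ∘ finSumFinEquiv.symm) (b ∘ finSumFinEquiv.symm) <| by
    intro φ
    have key (c : Fin n ⊕ Fin m → M) :
        Sum.elim (fun x : A => (x : M)) (c ∘ finSumFinEquiv.symm) =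
          Sum.elim (fun x : A => (x : M)) c ∘ Sum.map id finSumFinEquiv.symm := by
      rw [Sum.elim_comp_map, Function.comp_id]
    rw [key, key, ← Language.Formula.realize_relabel, ← Language.Formula.realize_relabel]
    exact hab _
  refine ⟨σ, hσ, funext fun i => ?_⟩
  simpa using hab' (finSumFinEquiv i)

/-- An invariant set of pairs with a finite fibre over a complete type is a finite union of
complete types, hence type-definable. -/
theorem IsInvariant.typeDefinable {A : Set M} (hhom : StronglyHomogeneousOver L A) {n m : ℕ}
    {a : Fin n → M} {C : Set ((Fin n → M) × (Fin m → M))} (hC : IsInvariant L A C)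
    (hsub : ∀ c ∈ C, c.1 ∈ typeSet L A a) (hfin : {y | (a, y) ∈ C}.Finite) :
    TypeDefinable L A (pairSet C) := by
  have ha : a ∈ typeSet L A a := fun _ => Iff.rfl
  refine typeDefinable_of_forall_notMem fun v hv => ?_
  have hsep : ∀ y : {y | (a, y) ∈ C}, ∃ φ : L.Formula (A ⊕ (Fin n ⊕ Fin m)),
      φ.Realize (Sum.elim (fun x => (x : M)) (Sum.elim a y)) ∧
        ¬ φ.Realize (Sum.elim (fun x => (x : M)) v) := by
    rintro ⟨y, hy⟩
    by_contra! hcon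
    have hsame : SameType L A (Sum.elim a y) v := by
      refine fun φ => ⟨hcon φ, fun hφ => ?_⟩
      by_contra hn
      exact Language.Formula.realize_not.1 (hcon φ.not (Language.Formula.realize_not.2 hn)) hφ
    obtain ⟨σ, hσ, rfl⟩ := hhom.exists_equiv_pair hsame
    exact hv ((hC σ hσ a y).2 hy)
  choose φ hφ hφv using hsep
  have : Finite {y | (a, y) ∈ C} := hfin
  refine ⟨⋃ y, {w | (φ y).Realize (Sum.elim (fun x => (x : M)) w)},
    definable_iUnion_of_finite fun y => definable_iff_exists_formula_sum.2 ⟨φ y, rfl⟩,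
    fun w hw => ?_, by simpa using hφv⟩
  obtain ⟨σ, hσ, hσa⟩ := hhom.exists_equiv (hsub _ hw) ha
  have hy : (a, σ ∘ w ∘ Sum.inr) ∈ C := by
    rw [← hσa]
    exact (hC σ hσ _ _).2 hw
  refine mem_iUnion.2 ⟨⟨_, hy⟩, (sameType_comp_equiv σ hσ w _).2 ?_⟩
  have hw' : σ ∘ w = Sum.elim a (σ ∘ w ∘ Sum.inr) := by
    rw [← hσa]
    exact (Sum.elim_comp_inl_inr (σ ∘ w)).symm
  rw [hw']
  exact hφ _

theorem injective_comp_equiv {α : Type*} (σ : M ≃[L] M) :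
    Function.Injective fun x : α → M => σ ∘ x :=
  σ.injective.comp_left

theorem surjective_comp_equiv {α : Type*} (σ : M ≃[L] M) :
    Function.Surjective fun x : α → M => σ ∘ x :=
  σ.surjective.comp_left

theorem IsInvariant.image_fiber {A : Set M} {n m : ℕ} {C : Set ((Fin n → M) × (Fin m → M))}
    (hC : IsInvariant L A C) (σ : M ≃[L] M) (hσ : ∀ x ∈ A, σ x = x) (x : Fin n → M) :
    {y | (σ ∘ x, y) ∈ C} = (fun y => σ ∘ y) '' {y | (x, y) ∈ C} := by
  ext y
  obtain ⟨y, rfl⟩ := surjective_comp_equiv σ y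
  rw [(injective_comp_equiv σ).mem_set_image]
  exact hC σ hσ x y

theorem IsInvariant.swap {A : Set M} {n m : ℕ} {C : Set ((Fin n → M) × (Fin m → M))}
    (hC : IsInvariant L A C) : IsInvariant L A (Prod.swap ⁻¹' C) :=
  fun σ hσ x y => hC σ hσ y x

/-- The fibres of a nonempty invariant set of pairs over a complete type have constant positive
cardinality. -/
theorem IsInvariant.exists_card_fiber {A : Set M} (hhom : StronglyHomogeneousOver L A)
    {n m : ℕ} {a : Fin n → M} {C : Set ((Fin n → M) × (Fin m → M))} (hC : IsInvariant L A C)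
    (hne : C.Nonempty) (hsub : ∀ c ∈ C, c.1 ∈ typeSet L A a)
    (hfin : ∀ x ∈ typeSet L A a, {y | (x, y) ∈ C}.Finite) :
    ∃ k, 0 < k ∧ ∀ x ∈ typeSet L A a, {y | (x, y) ∈ C}.ncard = k := by
  obtain ⟨⟨x, y⟩, hxy⟩ := hne
  have hx := hsub _ hxy
  refine ⟨_, (ncard_pos (hfin x hx)).2 ⟨y, hxy⟩, fun x' hx' => ?_⟩
  obtain ⟨σ, hσ, rfl⟩ := hhom.exists_equiv hx hx'
  rw [hC.image_fiber σ hσ, ncard_image_of_injective _ (injective_comp_equiv σ)]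

/-- A nonempty invariant set of pairs between complete types with finite fibres and cofibres is a
uniform correspondence. -/
theorem IsInvariant.exists_isUniformCorrespondence {A : Set M}
    (hhom : StronglyHomogeneousOver L A) {n m : ℕ} {a : Fin n → M} {b : Fin m → M}
    {C : Set ((Fin n → M) × (Fin m → M))} (hC : IsInvariant L A C) (hne : C.Nonempty)
    (hsub : C ⊆ typeSet L A a ×ˢ typeSet L A b)
    (hfin : ∀ x ∈ typeSet L A a, {y | (x, y) ∈ C}.Finite)
    (hcofin : ∀ y ∈ typeSet L A b, {x | (x, y) ∈ C}.Finite) :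
    ∃ k l, IsUniformCorrespondence L A (typeSet L A a) (typeSet L A b) C k l := by
  obtain ⟨k, hk, hk'⟩ := hC.exists_card_fiber hhom hne (fun c hc => (hsub hc).1) hfin
  obtain ⟨l, hl, hl'⟩ := hC.swap.exists_card_fiber hhom
    (hne.preimage Prod.swap_surjective) (fun c hc => (hsub hc).2) hcofin
  exact ⟨k, l, ⟨hne, hsub,
    hC.typeDefinable hhom (fun c hc => (hsub hc).1) (hfin a fun _ => Iff.rfl), hfin, hcofin⟩,
    hk, hl, hk', hl'⟩

open scoped ENNReal

/-- An invariant weight on pairs, supported on `X × Y`, with all row sums over `X` equal to `k`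
and all column sums over `Y` equal to `l`. -/
structure IsUniformKernel (L : FirstOrder.Language.{u, v}) [L.Structure M] (A : Set M) {n m : ℕ}
    (X : Set (Fin n → M)) (Y : Set (Fin m → M)) (f : (Fin n → M) → (Fin m → M) → ℝ≥0∞)
    (k l : ℝ≥0∞) : Prop where
  invariant : ∀ σ : M ≃[L] M, (∀ x ∈ A, σ x = x) → ∀ x y, f (σ ∘ x) (σ ∘ y) = f x y
  support : ∀ x y, f x y ≠ 0 → x ∈ X ∧ y ∈ Y
  row_sum : ∀ x ∈ X, ∑' y, f x y = k
  col_sum : ∀ y ∈ Y, ∑' x, f x y = l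

theorem tsum_indicator_one {α : Type*} {s : Set α} (hs : s.Finite) :
    ∑' x, s.indicator (1 : α → ℝ≥0∞) x = s.ncard := by
  rw [← tsum_subtype s (1 : α → ℝ≥0∞)]
  refine (ENNReal.tsum_set_one s).trans ?_
  rw [← hs.cast_ncard_eq]
  rfl

theorem IsUniformCorrespondence.isUniformKernel {A : Set M} {n m : ℕ} {X : Set (Fin n → M)}
    {Y : Set (Fin m → M)} {C : Set ((Fin n → M) × (Fin m → M))} {k l : ℕ}
    (h : IsUniformCorrespondence L A X Y C k l) :
    IsUniformKernel L A X Y (fun x y => C.indicator 1 (x, y)) k l where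
  invariant σ hσ x y := by
    classical
    simp only [indicator_apply, isInvariant_of_typeDefinable h.typeDefinable σ hσ x y, Pi.one_apply]
  support x y hxy := h.subset (mem_of_indicator_ne_zero hxy)
  row_sum x hx := by
    rw [← h.fiber_card x hx, ← tsum_indicator_one (h.finite_fibers x hx)]
    rfl
  col_sum y hy := by
    rw [← h.cofiber_card y hy, ← tsum_indicator_one (h.finite_cofibers y hy)]
    rfl

theorem IsUniformKernel.swap {A : Set M} {n m : ℕ} {X : Set (Fin n → M)} {Y : Set (Fin m → M)}
    {f : (Fin n → M) → (Fin m → M) → ℝ≥0∞} {k l : ℝ≥0∞} (h : IsUniformKernel L A X Y f k l) :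
    IsUniformKernel L A Y X (fun y x => f x y) l k where
  invariant σ hσ x y := h.invariant σ hσ y x
  support x y hxy := (h.support y x hxy).symm
  row_sum := h.col_sum
  col_sum := h.row_sum

theorem IsUniformKernel.tsum_comp {A : Set M} {n m r : ℕ} {X : Set (Fin n → M)}
    {Y : Set (Fin m → M)} {Z : Set (Fin r → M)} {f : (Fin n → M) → (Fin m → M) → ℝ≥0∞}
    {g : (Fin m → M) → (Fin r → M) → ℝ≥0∞} {k l k' l' : ℝ≥0∞}
    (hf : IsUniformKernel L A X Y f k l) (hg : IsUniformKernel L A Y Z g k' l')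
    {x : Fin n → M} (hx : x ∈ X) : ∑' z, ∑' y, f x y * g y z = k * k' := by
  rw [ENNReal.tsum_comm, ← hf.row_sum x hx, ← ENNReal.tsum_mul_right]
  refine tsum_congr fun y => ?_
  rw [ENNReal.tsum_mul_left]
  rcases eq_or_ne (f x y) 0 with h0 | h0
  · simp [h0]
  · rw [hg.row_sum y (hf.support x y h0).2]

theorem IsUniformKernel.comp {A : Set M} {n m r : ℕ} {X : Set (Fin n → M)}
    {Y : Set (Fin m → M)} {Z : Set (Fin r → M)} {f : (Fin n → M) → (Fin m → M) → ℝ≥0∞}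
    {g : (Fin m → M) → (Fin r → M) → ℝ≥0∞} {k l k' l' : ℝ≥0∞}
    (hf : IsUniformKernel L A X Y f k l) (hg : IsUniformKernel L A Y Z g k' l') :
    IsUniformKernel L A X Z (fun x z => ∑' y, f x y * g y z) (k * k') (l' * l) where
  invariant σ hσ x z := by
    rw [← (Equiv.ofBijective _ ⟨injective_comp_equiv σ, surjective_comp_equiv σ⟩).tsum_eq
      fun y => f (σ ∘ x) y * g y (σ ∘ z)]
    exact tsum_congr fun y => congrArg₂ _ (hf.invariant σ hσ x y) (hg.invariant σ hσ y z)
  support x z hxz := by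
    obtain ⟨y, hy⟩ : ∃ y, f x y * g y z ≠ 0 := by
      by_contra! h0
      exact hxz (ENNReal.tsum_eq_zero.2 h0)
    exact ⟨(hf.support x y (left_ne_zero_of_mul hy)).1,
      (hg.support y z (right_ne_zero_of_mul hy)).2⟩
  row_sum x hx := hf.tsum_comp hg hx
  col_sum z hz := by
    simpa only [mul_comm] using hg.swap.tsum_comp hf.swap hz

/-- Summation of a weight over its level sets. -/
theorem tsum_eq_tsum_level {α : Type*} (f : α → ℝ≥0∞) (hf : ∑' x, f x ≠ ∞) :
    ∑' x, f x = ∑' c : ℝ≥0∞, c * ({x | f x = c}.ncard : ℝ≥0∞) := by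
  have hlevel (x : α) : f x = ∑' c, c * {x | f x = c}.indicator (1 : α → ℝ≥0∞) x := by
    rw [tsum_eq_single (f x)]
    · simp
    · intro c hc
      simp [hc.symm]
  rw [tsum_congr hlevel, ENNReal.tsum_comm]
  refine tsum_congr fun c => ?_
  rcases eq_or_ne c 0 with rfl | hc
  · simp
  · rw [ENNReal.tsum_mul_left, tsum_indicator_one]
    exact (ENNReal.finite_const_le_of_tsum_ne_top hf hc).subset fun x hx => hx.ge

/-- Mass transport: over a measurable complete type, the row and column sums of a uniform kernel
agree. -/
theorem MeasurableOver.kernel_eq {A : Set M} (hhom : StronglyHomogeneousOver L A) {n : ℕ}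
    {a : Fin n → M} (hp : MeasurableOver L A (typeSet L A a))
    {f : (Fin n → M) → (Fin n → M) → ℝ≥0∞} {k l : ℝ≥0∞}
    (h : IsUniformKernel L A (typeSet L A a) (typeSet L A a) f k l) (hk : k ≠ ∞) (hl : l ≠ ∞) :
    k = l := by
  have ha : a ∈ typeSet L A a := fun _ => Iff.rfl
  rw [← h.row_sum a ha] at hk ⊢
  rw [← h.col_sum a ha, tsum_eq_tsum_level _ hk, tsum_eq_tsum_level (fun x => f x a)
    (by rwa [h.col_sum a ha])]
  rw [h.row_sum a ha] at hk
  refine tsum_congr fun c => ?_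
  rcases eq_or_ne c 0 with rfl | hc
  · simp
  set C : Set ((Fin n → M) × (Fin n → M)) := {p | f p.1 p.2 = c} with hCdef
  have hfiber : {y | f a y = c} = {y | (a, y) ∈ C} := rfl
  have hcofiber : {x | f x a = c} = {x | (x, a) ∈ C} := rfl
  rw [hfiber, hcofiber]
  rcases C.eq_empty_or_nonempty with h0 | hne
  · simp [h0]
  have hfin : ∀ x ∈ typeSet L A a, {y | (x, y) ∈ C}.Finite := fun x hx =>
    (ENNReal.finite_const_le_of_tsum_ne_top (a := f x) (by rwa [h.row_sum x hx]) hc).subset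
      fun y hy => ge_of_eq hy
  have hcofin : ∀ y ∈ typeSet L A a, {x | (x, y) ∈ C}.Finite := fun y hy =>
    (ENNReal.finite_const_le_of_tsum_ne_top (a := fun x => f x y)
      (by rwa [h.col_sum y hy]) hc).subset fun x hx => ge_of_eq hx
  obtain ⟨i, j, hij⟩ := IsInvariant.exists_isUniformCorrespondence hhom (C := C) (b := a)
    (fun σ hσ x y => by simp only [hCdef, mem_ofPred_eq, h.invariant σ hσ]) hne
    (fun p hp => h.support p.1 p.2 (by rw [show f p.1 p.2 = c from hp]; exact hc)) hfin hcofin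
  rw [hij.fiber_card a ha, hij.cofiber_card a ha, hp C i j hij]

end Automorphisms

/-- If there is a correspondence over `A` between the complete types `p` and `q`
and `p` is measurable over `A`, then `q` is measurable over `A` and `p(M)`, `q(M)` are
commensurable over `A`. -/
theorem statement10 (L : FirstOrder.Language.{u, v}) (M : Type w) [L.Structure M]
    (A : Set M) (hhom : StronglyHomogeneousOver L A) (n m : ℕ)
    (a : Fin n → M) (b : Fin m → M)
    (hex : ∃ C, IsCorrespondence L A (typeSet L A a) (typeSet L A b) C)
    (hp : MeasurableOver L A (typeSet L A a)) :
    MeasurableOver L A (typeSet L A b) ∧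
      CommensurableOver L A (typeSet L A a) (typeSet L A b) := by
  obtain ⟨C, hC⟩ := hex
  have hinv := isInvariant_of_typeDefinable hC.typeDefinable
  obtain ⟨k, l, hU⟩ := hinv.exists_isUniformCorrespondence hhom hC.nonempty hC.subset
    hC.finite_fibers hC.finite_cofibers
  refine ⟨fun D k' l' hD => ?_, (k : ℚ) / l, ⟨C, k, l, hU⟩, fun D k' l' hD => ?_⟩
  · have h := hp.kernel_eq hhom
      ((hU.isUniformKernel.comp hD.isUniformKernel).comp hU.isUniformKernel.swap)
      (by finiteness) (by finiteness)
    have h' : k * k' * l = k * (l' * l) := by exact_mod_cast h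
    exact Nat.eq_of_mul_eq_mul_left (Nat.mul_pos hU.k_pos hU.l_pos) (by linarith)
  · have h := hp.kernel_eq hhom (hU.isUniformKernel.comp hD.isUniformKernel.swap)
      (by finiteness) (by finiteness)
    have h' : k * l' = k' * l := by exact_mod_cast h
    have hl : (l : ℚ) ≠ 0 := by exact_mod_cast hU.l_pos.ne'
    have hl' : (l' : ℚ) ≠ 0 := by exact_mod_cast hD.l_pos.ne'
    rw [div_eq_div_iff hl' hl]
    exact_mod_cast h'.symm

end Unimod
end

section
/- Let M be an L-structure, A ⊆ M, and suppose M is strongly homogeneous over A. Let p and q be complete types over A. If p(M) and q(M) are commensurable over A, then both p and q are measurable over A. -/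
open FirstOrder Set

namespace Unimod

universe u v w

variable (L : FirstOrder.Language.{u, v}) {M : Type w} [L.Structure M]

section GroupAction

open MulAction

variable {G α β : Type*} [Group G] [MulAction G α] [MulAction G β]

theorem fiber_orbit_eq_orbit_stabilizer (u : α) (v : β) :
    {y | (u, y) ∈ orbit G (u, v)} = orbit (stabilizer G u) v := by
  ext y
  constructor
  · rintro ⟨g, hg⟩
    obtain ⟨h₁, h₂⟩ := Prod.mk.inj hg
    exact ⟨⟨g, h₁⟩, h₂⟩
  · rintro ⟨⟨g, h₁⟩, h₂⟩
    exact ⟨g, Prod.ext h₁ h₂⟩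

theorem ncard_fiber_orbit {u x : α} (v : β) (hx : x ∈ orbit G u) :
    {y | (x, y) ∈ orbit G (u, v)}.ncard = (stabilizer G v).relIndex (stabilizer G u) := by
  obtain ⟨g, rfl⟩ := hx
  have himage : {y | (g • u, y) ∈ orbit G (u, v)} =
      (g • ·) '' {y | (u, y) ∈ orbit G (u, v)} := by
    ext y
    constructor
    · intro hy
      obtain ⟨h, hh⟩ := mem_orbit_iff.1 hy
      exact ⟨g⁻¹ • y, ⟨g⁻¹ * h, by simp [mul_smul, hh]⟩, smul_inv_smul g y⟩
    · rintro ⟨z, hz, rfl⟩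
      obtain ⟨h, hh⟩ := mem_orbit_iff.1 hz
      exact mem_orbit_iff.2 ⟨g * h, by rw [mul_smul, hh, Prod.smul_mk]⟩
  change {y | (g • u, y) ∈ orbit G (u, v)}.ncard = _
  rw [himage, Set.ncard_image_of_injective _ (MulAction.injective g),
    fiber_orbit_eq_orbit_stabilizer, ← index_stabilizer]
  rfl

theorem ncard_cofiber_orbit (u : α) {v y : β} (hy : y ∈ orbit G v) :
    {x | (x, y) ∈ orbit G (u, v)}.ncard = (stabilizer G u).relIndex (stabilizer G v) := by
  rw [← ncard_fiber_orbit u hy]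
  congr 1
  ext x
  simp [mem_orbit_iff, and_comm]

theorem relIndex_stabilizer_ne_zero {C : Set (α × β)} (hC : ∀ (g : G), ∀ c ∈ C, g • c ∈ C)
    {u : α} {v : β} (huv : (u, v) ∈ C) (hfin : {y | (u, y) ∈ C}.Finite) :
    (stabilizer G v).relIndex (stabilizer G u) ≠ 0 := by
  rw [← ncard_fiber_orbit v (mem_orbit_self (M := G) u)]
  have hv : v ∈ {y | (u, y) ∈ orbit G (u, v)} := mem_orbit_self _
  refine Set.ncard_ne_zero_of_mem hv (hfin.subset ?_)
  rintro y ⟨g, hg⟩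
  have := hC g _ huv
  rwa [show g • (u, v) = (u, y) from hg] at this

theorem relIndex_stabilizer_ne_zero' {C : Set (α × β)} (hC : ∀ (g : G), ∀ c ∈ C, g • c ∈ C)
    {u : α} {v : β} (huv : (u, v) ∈ C) (hfin : {x | (x, v) ∈ C}.Finite) :
    (stabilizer G u).relIndex (stabilizer G v) ≠ 0 :=
  relIndex_stabilizer_ne_zero (C := Prod.swap ⁻¹' C) (fun g _ hc => hC g _ hc) huv hfin

/-- The relative indices of three pairwise commensurable subgroups satisfy the cocycle
identity. -/
theorem relIndex_cocycle {H K N : Subgroup G} (hHK : H.relIndex K ≠ 0) (hKN : K.relIndex N ≠ 0)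
    (hNH : N.relIndex H ≠ 0) :
    K.relIndex N * N.relIndex H * H.relIndex K = N.relIndex K * H.relIndex N * K.relIndex H := by
  have h₁ : H.relIndex (K ⊓ N) * K.relIndex N = K.relIndex (H ⊓ N) * H.relIndex N := by
    rw [Subgroup.relIndex_inf_mul_relIndex, Subgroup.relIndex_inf_mul_relIndex, inf_comm]
  have h₂ : K.relIndex (H ⊓ N) * N.relIndex H = N.relIndex (H ⊓ K) * K.relIndex H := by
    rw [inf_comm H N, inf_comm H K, Subgroup.relIndex_inf_mul_relIndex,
      Subgroup.relIndex_inf_mul_relIndex, inf_comm]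
  have h₃ : N.relIndex (H ⊓ K) * H.relIndex K = H.relIndex (K ⊓ N) * N.relIndex K := by
    rw [inf_comm K N, Subgroup.relIndex_inf_mul_relIndex,
      Subgroup.relIndex_inf_mul_relIndex, inf_comm]
  have h0₁ : H.relIndex (K ⊓ N) ≠ 0 := fun h =>
    hHK (Subgroup.relIndex_eq_zero_of_le_right inf_le_left h)
  have h0₂ : K.relIndex (H ⊓ N) ≠ 0 := fun h =>
    hKN (Subgroup.relIndex_eq_zero_of_le_right inf_le_right h)
  have h0₃ : N.relIndex (H ⊓ K) ≠ 0 := fun h =>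
    hNH (Subgroup.relIndex_eq_zero_of_le_right inf_le_left h)
  refine mul_left_cancel₀ (mul_ne_zero (mul_ne_zero h0₁ h0₂) h0₃) ?_
  calc _ = (H.relIndex (K ⊓ N) * K.relIndex N) * (K.relIndex (H ⊓ N) * N.relIndex H) *
        (N.relIndex (H ⊓ K) * H.relIndex K) := by ring
    _ = _ := by rw [h₁, h₂, h₃]; ring

/-- If every orbit in an invariant relation on a transitive set is balanced, so is the
relation. -/
theorem ncard_fiber_eq_ncard_cofiber {E : Set (α × α)} (hE : ∀ (g : G), ∀ c ∈ E, g • c ∈ E)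
    (x : α) (hsub : E ⊆ orbit G x ×ˢ orbit G x)
    (hne : ∀ u v, (u, v) ∈ E → (stabilizer G v).relIndex (stabilizer G u) ≠ 0)
    (hbal : ∀ u v, (u, v) ∈ E →
      (stabilizer G v).relIndex (stabilizer G u) = (stabilizer G u).relIndex (stabilizer G v)) :
    {y | (x, y) ∈ E}.ncard = {y | (y, x) ∈ E}.ncard := by
  have hinv : ∀ c d, d ∈ orbit G c → c ∈ E → d ∈ E := by
    rintro c _ ⟨g, rfl⟩ hc
    exact hE g c hc
  let f : {y | (x, y) ∈ E} → orbitRel.Quotient G (α × α) := fun y => ⟦(x, y.1)⟧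
  let f' : {y | (y, x) ∈ E} → orbitRel.Quotient G (α × α) := fun y => ⟦(y.1, x)⟧
  have key : ∀ q, Nonempty ({y // f y = q} ≃ {y // f' y = q}) := by
    intro q
    induction q using Quotient.inductionOn with | h c =>
    obtain ⟨u, v⟩ := c
    have hf : ∀ y, f y = ⟦(u, v)⟧ ↔ (x, y.1) ∈ orbit G (u, v) := fun y => Quotient.eq
    have hf' : ∀ y, f' y = ⟦(u, v)⟧ ↔ (y.1, x) ∈ orbit G (u, v) := fun y => Quotient.eq
    by_cases huv : (u, v) ∈ E
    · have e : {y // f y = ⟦(u, v)⟧} ≃ {y | (x, y) ∈ orbit G (u, v)} :=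
        ⟨fun y => ⟨y.1.1, (hf _).1 y.2⟩,
          fun y => ⟨⟨y.1, hinv _ _ y.2 huv⟩, (hf _).2 y.2⟩, fun _ => rfl, fun _ => rfl⟩
      have e' : {y // f' y = ⟦(u, v)⟧} ≃ {y | (y, x) ∈ orbit G (u, v)} :=
        ⟨fun y => ⟨y.1.1, (hf' _).1 y.2⟩,
          fun y => ⟨⟨y.1, hinv _ _ y.2 huv⟩, (hf' _).2 y.2⟩, fun _ => rfl, fun _ => rfl⟩
      have h₁ := ncard_fiber_orbit v (mem_orbit_symm.1 (hsub huv).1)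
      have h₂ := ncard_cofiber_orbit u (mem_orbit_symm.1 (hsub huv).2)
      have hfin := Set.finite_of_ncard_ne_zero (h₁.trans_ne (hne u v huv))
      have hfin' := Set.finite_of_ncard_ne_zero
        (h₂.trans_ne ((hbal u v huv).symm.trans_ne (hne u v huv)))
      have := hfin.to_subtype
      have := hfin'.to_subtype
      exact (Finite.card_eq.1 (h₁.trans ((hbal u v huv).trans h₂.symm))).map
        fun i => e.trans (i.trans e'.symm)
    · have : IsEmpty {y // f y = ⟦(u, v)⟧} :=
        ⟨fun y => huv (hinv _ _ (mem_orbit_symm.1 ((hf _).1 y.2)) y.1.2)⟩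
      have : IsEmpty {y // f' y = ⟦(u, v)⟧} :=
        ⟨fun y => huv (hinv _ _ (mem_orbit_symm.1 ((hf' _).1 y.2)) y.1.2)⟩
      exact ⟨Equiv.equivOfIsEmpty _ _⟩
  exact Nat.card_congr ((Equiv.sigmaFiberEquiv f).symm.trans
    ((Equiv.sigmaCongrRight fun q => (key q).some).trans (Equiv.sigmaFiberEquiv f')))

end GroupAction

section Types

variable {L} {A : Set M}

theorem SameType.comp {α β : Type*} {a b : α → M} (h : SameType L A a b) (f : β → α) :
    SameType L A (a ∘ f) (b ∘ f) := by
  intro φ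
  have := h (φ.relabel (Sum.map id f))
  simpa only [Language.Formula.realize_relabel, Sum.elim_comp_map, Function.comp_id] using this

theorem sameType_of_equiv {α : Type*} (σ : M ≃[L] M) (hσ : ∀ x ∈ A, σ x = x) (a : α → M) :
    SameType L A a (σ ∘ a) := by
  intro φ
  have h : Sum.elim (fun x : A => (x : M)) (σ ∘ a) = σ ∘ Sum.elim (fun x : A => (x : M)) a := by
    ext (x | x)
    · exact (hσ x x.2).symm
    · rfl
  rw [h, Language.StrongHomClass.realize_formula]

theorem TypeDefinable.mem_of_sameType {α : Type*} {s : Set (α → M)} (hs : TypeDefinable L A s)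
    {a b : α → M} (h : SameType L A a b) (ha : a ∈ s) : b ∈ s := by
  obtain ⟨S, hS, rfl⟩ := hs
  intro t ht
  obtain ⟨φ, rfl⟩ := Set.definable_iff_exists_formula_sum.1 (hS t ht)
  exact (h φ).1 (ha _ ht)

theorem typeDefinable_typeSet {α : Type*} (a : α → M) : TypeDefinable L A (typeSet L A a) := by
  refine ⟨{t | A.Definable L t ∧ a ∈ t}, fun t ht => ht.1, Set.Subset.antisymm ?_ ?_⟩
  · rintro b hb t ⟨ht, hat⟩
    obtain ⟨φ, rfl⟩ := Set.definable_iff_exists_formula_sum.1 ht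
    exact (hb φ).1 hat
  · intro b hb φ
    constructor
    · intro h
      exact hb _ ⟨Set.definable_iff_exists_formula_sum.2 ⟨φ, rfl⟩, h⟩
    · intro h
      by_contra h'
      have := hb _ ⟨Set.definable_iff_exists_formula_sum.2 ⟨φ.not, rfl⟩,
        Language.Formula.realize_not.2 h'⟩
      exact Language.Formula.realize_not.1 this h

variable (L A) in
/-- The group of permutations of `M` that are automorphisms fixing `A` pointwise. -/
def autGroup : Subgroup (Equiv.Perm M) where
  carrier := {g | ∃ σ : M ≃[L] M, (∀ x ∈ A, σ x = x) ∧ ∀ x, σ x = g x}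
  one_mem' := ⟨Language.Equiv.refl L M, fun _ _ => rfl, fun _ => rfl⟩
  mul_mem' := by
    rintro g h ⟨σ, hσA, hσ⟩ ⟨τ, hτA, hτ⟩
    refine ⟨σ.comp τ, fun x hx => ?_, fun x => ?_⟩
    · rw [Language.Equiv.comp_apply, hτA x hx, hσA x hx]
    · rw [Language.Equiv.comp_apply, hτ, hσ, Equiv.Perm.mul_apply]
  inv_mem' := by
    rintro g ⟨σ, hσA, hσ⟩
    refine ⟨σ.symm, fun x hx => ?_, fun x => ?_⟩
    · conv_lhs => rw [← hσA x hx]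
      exact σ.symm_apply_apply x
    · rw [Equiv.Perm.eq_inv_iff_eq, ← hσ]
      exact σ.apply_symm_apply x

theorem sameType_smul {α : Type*} (g : autGroup L A) (a : α → M) : SameType L A a (g • a) := by
  obtain ⟨g, σ, hσA, hσ⟩ := g
  convert sameType_of_equiv σ hσA a using 1
  ext i
  exact (hσ _).symm

theorem StronglyHomogeneousOver.sameType_iff (hhom : StronglyHomogeneousOver L A) {α : Type*}
    [Finite α] {a b : α → M} : SameType L A a b ↔ b ∈ MulAction.orbit (autGroup L A) a := by
  constructor
  · intro h
    obtain ⟨n, ⟨e⟩⟩ := Finite.exists_equiv_fin α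
    obtain ⟨σ, hσA, hσ⟩ := hhom n _ _ (h.comp e.symm)
    refine ⟨⟨σ.toEquiv, σ, hσA, fun _ => rfl⟩, ?_⟩
    ext i
    have := hσ (e i)
    simp only [Function.comp_apply, Equiv.symm_apply_apply] at this
    exact this
  · rintro ⟨g, rfl⟩
    exact sameType_smul g a

variable {n m : ℕ} {X : Set (Fin n → M)} {Y : Set (Fin m → M)}

theorem IsCorrespondence.smul_mem {C : Set ((Fin n → M) × (Fin m → M))}
    (hC : IsCorrespondence L A X Y C) (g : autGroup L A) :
    ∀ c ∈ C, g • c ∈ C := fun c hc =>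
  hC.typeDefinable.mem_of_sameType (sameType_smul g (Sum.elim c.1 c.2)) hc

theorem pairSet_pairClass (c : (Fin n → M) × (Fin m → M)) :
    pairSet (pairClass L A c) = typeSet L A (Sum.elim c.1 c.2) := by
  ext v
  change SameType L A _ (Sum.elim (v ∘ Sum.inl) (v ∘ Sum.inr)) ↔ SameType L A _ v
  rw [Sum.elim_comp_inl_inr]

theorem StronglyHomogeneousOver.pairClass_eq_orbit (hhom : StronglyHomogeneousOver L A)
    (c : (Fin n → M) × (Fin m → M)) :
    pairClass L A c = MulAction.orbit (autGroup L A) c := by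
  ext d
  refine hhom.sameType_iff.trans ⟨?_, ?_⟩
  · rintro ⟨g, hg⟩
    refine ⟨g, Prod.ext (funext fun i => ?_) (funext fun i => ?_)⟩
    · exact congrFun hg (Sum.inl i)
    · exact congrFun hg (Sum.inr i)
  · rintro ⟨g, rfl⟩
    refine ⟨g, funext ?_⟩
    rintro (i | i) <;> rfl

open MulAction in
theorem StronglyHomogeneousOver.isUniformCorrespondence_pairClass
    (hhom : StronglyHomogeneousOver L A) {a : Fin n → M} {b : Fin m → M} {x : Fin n → M}
    {y : Fin m → M} (hx : x ∈ typeSet L A a) (hy : y ∈ typeSet L A b)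
    (hxy : (stabilizer (autGroup L A) x).relIndex (stabilizer (autGroup L A) y) ≠ 0)
    (hyx : (stabilizer (autGroup L A) y).relIndex (stabilizer (autGroup L A) x) ≠ 0) :
    IsUniformCorrespondence L A (typeSet L A a) (typeSet L A b) (pairClass L A (x, y))
      ((stabilizer (autGroup L A) y).relIndex (stabilizer (autGroup L A) x))
      ((stabilizer (autGroup L A) x).relIndex (stabilizer (autGroup L A) y)) := by
  have hX : ∀ x' ∈ typeSet L A a, x' ∈ orbit (autGroup L A) x := fun x' hx' =>
    hhom.sameType_iff.1 fun φ => (hx φ).symm.trans (hx' φ)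
  have hY : ∀ y' ∈ typeSet L A b, y' ∈ orbit (autGroup L A) y := fun y' hy' =>
    hhom.sameType_iff.1 fun φ => (hy φ).symm.trans (hy' φ)
  have h₁ : ∀ x' ∈ typeSet L A a, {y' | (x', y') ∈ pairClass L A (x, y)}.ncard = _ :=
    fun x' hx' => hhom.pairClass_eq_orbit (x, y) ▸ ncard_fiber_orbit y (hX x' hx')
  have h₂ : ∀ y' ∈ typeSet L A b, {x' | (x', y') ∈ pairClass L A (x, y)}.ncard = _ :=
    fun y' hy' => hhom.pairClass_eq_orbit (x, y) ▸ ncard_cofiber_orbit x (hY y' hy')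
  exact
    { nonempty := ⟨(x, y), fun _ => Iff.rfl⟩
      subset := fun c hc =>
        ⟨fun φ => (hx φ).trans (SameType.comp hc Sum.inl φ),
          fun φ => (hy φ).trans (SameType.comp hc Sum.inr φ)⟩
      typeDefinable := pairSet_pairClass (L := L) (A := A) (x, y) ▸ typeDefinable_typeSet _
      finite_fibers := fun x' hx' => Set.finite_of_ncard_ne_zero ((h₁ x' hx').trans_ne hyx)
      finite_cofibers := fun y' hy' => Set.finite_of_ncard_ne_zero ((h₂ y' hy').trans_ne hxy)
      k_pos := Nat.pos_of_ne_zero hyx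
      l_pos := Nat.pos_of_ne_zero hxy
      fiber_card := h₁
      cofiber_card := h₂ }

open MulAction in
/-- A complete type is measurable as soon as any two interalgebraic realizations have
equal mutual indices. -/
theorem StronglyHomogeneousOver.measurableOver_typeSet (hhom : StronglyHomogeneousOver L A)
    {a : Fin n → M}
    (h : ∀ u ∈ typeSet L A a, ∀ v ∈ typeSet L A a,
      (stabilizer (autGroup L A) u).relIndex (stabilizer (autGroup L A) v) ≠ 0 →
      (stabilizer (autGroup L A) v).relIndex (stabilizer (autGroup L A) u) ≠ 0 →
      (stabilizer (autGroup L A) v).relIndex (stabilizer (autGroup L A) u) =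
        (stabilizer (autGroup L A) u).relIndex (stabilizer (autGroup L A) v)) :
    MeasurableOver L A (typeSet L A a) := by
  intro E k l hE
  have ha : a ∈ typeSet L A a := fun _ => Iff.rfl
  have hinv := hE.toIsCorrespondence.smul_mem
  have hne : ∀ u v, (u, v) ∈ E →
      (stabilizer (autGroup L A) v).relIndex (stabilizer (autGroup L A) u) ≠ 0 :=
    fun u v huv => relIndex_stabilizer_ne_zero hinv huv (hE.finite_fibers u (hE.subset huv).1)
  rw [← hE.fiber_card a ha, ← hE.cofiber_card a ha]
  refine ncard_fiber_eq_ncard_cofiber hinv a (fun c hc => ?_) hne fun u v huv => ?_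
  · exact ⟨hhom.sameType_iff.1 (hE.subset hc).1, hhom.sameType_iff.1 (hE.subset hc).2⟩
  · exact h u (hE.subset huv).1 v (hE.subset huv).2
      (relIndex_stabilizer_ne_zero' hinv huv (hE.finite_cofibers v (hE.subset huv).2))
      (hne u v huv)

end Types

/-- If the complete types `p` and `q` are commensurable over `A`, then both are
measurable over `A`. -/
theorem statement11 (L : FirstOrder.Language.{u, v}) (M : Type w) [L.Structure M]
    (A : Set M) (hhom : StronglyHomogeneousOver L A) (n m : ℕ)
    (a : Fin n → M) (b : Fin m → M)
    (hcomm : CommensurableOver L A (typeSet L A a) (typeSet L A b)) :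
    MeasurableOver L A (typeSet L A a) ∧ MeasurableOver L A (typeSet L A b) := by
  obtain ⟨r, ⟨D, k, l, hD⟩, hr⟩ := hcomm
  let S {i : ℕ} (t : Fin i → M) := MulAction.stabilizer (autGroup L A) t
  have hinv := hD.toIsCorrespondence.smul_mem
  have hyx : ∀ x y, (x, y) ∈ D → (S y).relIndex (S x) ≠ 0 := fun x y h =>
    relIndex_stabilizer_ne_zero hinv h (hD.finite_fibers x (hD.subset h).1)
  have hxy : ∀ x y, (x, y) ∈ D → (S x).relIndex (S y) ≠ 0 := fun x y h =>
    relIndex_stabilizer_ne_zero' hinv h (hD.finite_cofibers y (hD.subset h).2)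
  -- all interalgebraic pairs of realizations of the two types have the same ratio
  have hratio : ∀ x ∈ typeSet L A a, ∀ y ∈ typeSet L A b, ∀ x' ∈ typeSet L A a,
      ∀ y' ∈ typeSet L A b, (S x).relIndex (S y) ≠ 0 → (S y).relIndex (S x) ≠ 0 →
      (S x').relIndex (S y') ≠ 0 → (S y').relIndex (S x') ≠ 0 →
      (S y).relIndex (S x) * (S x').relIndex (S y') =
        (S y').relIndex (S x') * (S x).relIndex (S y) := by
    intro x hx y hy x' hx' y' hy' h₁ h₂ h₃ h₄
    have h := (hr _ _ _ (hhom.isUniformCorrespondence_pairClass hx hy h₁ h₂)).trans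
      (hr _ _ _ (hhom.isUniformCorrespondence_pairClass hx' hy' h₃ h₄)).symm
    rw [div_eq_div_iff (Nat.cast_ne_zero.2 h₁) (Nat.cast_ne_zero.2 h₃)] at h
    exact_mod_cast h
  refine ⟨hhom.measurableOver_typeSet fun u hu v hv huv hvu => ?_,
    hhom.measurableOver_typeSet fun u hu v hv huv hvu => ?_⟩
  · obtain ⟨y, hy⟩ : {y | (v, y) ∈ D}.Nonempty :=
      Set.nonempty_of_ncard_ne_zero (hD.fiber_card v hv ▸ hD.k_pos.ne')
    have h₁ := Subgroup.relIndex_ne_zero_trans huv (hxy v y hy)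
    have h₂ := Subgroup.relIndex_ne_zero_trans (hyx v y hy) hvu
    have hq := hratio u hu y (hD.subset hy).2 v hv y (hD.subset hy).2 h₁ h₂ (hxy v y hy)
      (hyx v y hy)
    have hc := relIndex_cocycle huv (hxy v y hy) h₂
    refine (mul_left_cancel₀ (mul_ne_zero (hyx v y hy) h₁) ?_)
    change _ * (S v).relIndex (S u) = _ * (S u).relIndex (S v)
    change (S v).relIndex (S y) * (S y).relIndex (S u) * (S u).relIndex (S v) =
      (S y).relIndex (S v) * (S u).relIndex (S y) * (S v).relIndex (S u) at hc
    rw [← hc, ← hq]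
    ring
  · obtain ⟨x, hx⟩ : {x | (x, u) ∈ D}.Nonempty :=
      Set.nonempty_of_ncard_ne_zero (hD.cofiber_card u hu ▸ hD.l_pos.ne')
    have h₁ := Subgroup.relIndex_ne_zero_trans (hxy x u hx) huv
    have h₂ := Subgroup.relIndex_ne_zero_trans hvu (hyx x u hx)
    have hq := hratio x (hD.subset hx).1 u hu x (hD.subset hx).1 v hv (hxy x u hx) (hyx x u hx)
      h₁ h₂
    have hc := relIndex_cocycle huv h₂ (hxy x u hx)
    refine (mul_left_cancel₀ (mul_ne_zero (hyx x u hx) h₁) ?_)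
    change _ * (S v).relIndex (S u) = _ * (S u).relIndex (S v)
    change (S v).relIndex (S x) * (S x).relIndex (S u) * (S u).relIndex (S v) =
      (S x).relIndex (S v) * (S u).relIndex (S x) * (S v).relIndex (S u) at hc
    linear_combination -hc - hq * (S u).relIndex (S v)

end Unimod
end

section
/- Let (M_i)_{i ∈ I} be a family of nonempty finite L-structures, 𝒰 an ultrafilter on I, and M = ∏_𝒰 M_i the ultraproduct. Then every uniform definable correspondence between a definable set X ⊆ M^n and itself is balanced. Consequently, for all definable sets X, Y in M, any two uniform definable correspondences between X and Y have the same ratio. -/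
open FirstOrder Set

namespace Unimod

universe u v w

variable (L : FirstOrder.Language.{u, v}) {M : Type w} [L.Structure M]

/-- A definable correspondence between definable sets `X` and `Y`, uniform with fibre sizes
`k` and `ℓ`. -/
structure IsDefUniformCorrespondence {n m : ℕ} (X : Set (Fin n → M)) (Y : Set (Fin m → M))
    (C : Set ((Fin n → M) × (Fin m → M))) (k ℓ : ℕ) : Prop where
  nonempty : C.Nonempty
  subset : C ⊆ X ×ˢ Y
  definable : (Set.univ : Set M).Definable L (pairSet C)
  k_pos : 0 < k
  l_pos : 0 < ℓ
  finite_fibers : ∀ x ∈ X, {y | (x, y) ∈ C}.Finite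
  finite_cofibers : ∀ y ∈ Y, {x | (x, y) ∈ C}.Finite
  fiber_card : ∀ x ∈ X, {y | (x, y) ∈ C}.ncard = k
  cofiber_card : ∀ y ∈ Y, {x | (x, y) ∈ C}.ncard = ℓ

/-- The graph of a function `f` on the set `X`, as a set of `Fin n ⊕ Fin m`-indexed tuples. -/
def graphOn {M : Type w} {n m : ℕ} (X : Set (Fin n → M)) (f : (Fin n → M) → (Fin m → M)) :
    Set ((Fin n ⊕ Fin m) → M) :=
  {v | v ∘ Sum.inl ∈ X ∧ f (v ∘ Sum.inl) = v ∘ Sum.inr}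

/-- The tuple of elements of the reduced product represented by a family of tuples. -/
def productTuple {I : Type*} (l : Filter I) {Mi : I → Type*} {α : Type*} (x : ∀ i, α → Mi i) :
    α → l.Product Mi :=
  fun j => ((fun i => x i j : ∀ i, Mi i) : l.Product Mi)

theorem productTuple_surjective {I : Type*} (l : Filter I) {Mi : I → Type*} {α : Type*} :
    Function.Surjective (productTuple l (Mi := Mi) (α := α)) := by
  intro y
  refine ⟨fun i j => (y j).out i, funext fun j => ?_⟩
  exact Quotient.out_eq (y j)

theorem productTuple_eq_iff {I : Type*} (l : Filter I) {Mi : I → Type*} {α : Type*} [Finite α]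
    (x y : ∀ i, α → Mi i) :
    productTuple l x = productTuple l y ↔ ∀ᶠ i in l, x i = y i := by
  simp only [funext_iff, Filter.eventually_all]
  exact forall_congr' fun j => Quotient.eq''

/-- A set of tuples in the reduced product is the internal set given by a family `S`. -/
def IsInternal {I : Type*} (l : Filter I) {Mi : I → Type*} {α : Type*}
    (S : ∀ i, Set (α → Mi i)) (X : Set (α → l.Product Mi)) : Prop :=
  ∀ x : ∀ i, α → Mi i, productTuple l x ∈ X ↔ ∀ᶠ i in l, x i ∈ S i

/-- Definable sets in an ultraproduct are internal. -/
theorem exists_isInternal_of_definable {L : FirstOrder.Language.{u, v}} {I : Type*}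
    {Mi : I → Type*} [∀ i, L.Structure (Mi i)] [∀ i, Nonempty (Mi i)] (𝒰 : Ultrafilter I)
    {α : Type*} {A : Set ((𝒰 : Filter I).Product Mi)} {X : Set (α → (𝒰 : Filter I).Product Mi)}
    (hX : A.Definable L X) : ∃ S : ∀ i, Set (α → Mi i), IsInternal (𝒰 : Filter I) S X := by
  obtain ⟨φ, rfl⟩ := Set.definable_iff_exists_formula_sum.1 hX
  refine ⟨fun i => {x | φ.Realize (Sum.elim (fun a : A => a.1.out i) x)}, fun x => ?_⟩
  have h := Language.Ultraproduct.realize_formula_cast (u := 𝒰) φ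
    (Sum.elim (fun (a : A) i => a.1.out i) fun j i => x i j)
  have h₁ : (fun i => ((Sum.elim (fun (a : A) i => a.1.out i) (fun j i => x i j) i :
      ∀ i, Mi i) : (𝒰 : Filter I).Product Mi)) =
      Sum.elim (fun a : A => (a : (𝒰 : Filter I).Product Mi)) (productTuple 𝒰 x) := by
    funext s
    rcases s with a | j
    · exact Quotient.out_eq a.1
    · rfl
  have h₂ (i : I) : (fun s => Sum.elim (fun (a : A) i => a.1.out i) (fun j i => x i j) s i) =
      Sum.elim (fun a : A => a.1.out i) (x i) := by
    funext s
    rcases s with a | j <;> rfl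
  rw [h₁] at h
  simp only [h₂] at h
  exact h

section Internal

variable {I : Type*} {Mi : I → Type*} {𝒰 : Ultrafilter I} {α : Type*}

theorem IsInternal.eventually_forall {S : ∀ i, Set (α → Mi i)}
    {X : Set (α → (𝒰 : Filter I).Product Mi)} (hS : IsInternal (𝒰 : Filter I) S X)
    [∀ i, Nonempty (Mi i)] {P : ∀ i, (α → Mi i) → Prop}
    (h : ∀ x : ∀ i, α → Mi i, productTuple (𝒰 : Filter I) x ∈ X →
      ∀ᶠ i in (𝒰 : Filter I), P i (x i)) :
    ∀ᶠ i in (𝒰 : Filter I), ∀ x ∈ S i, P i x := by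
  by_contra hn
  rw [← Ultrafilter.eventually_not] at hn
  let y : ∀ i, α → Mi i := fun i => Classical.epsilon fun z => z ∈ S i ∧ ¬ P i z
  have hy : ∀ᶠ i in (𝒰 : Filter I), y i ∈ S i ∧ ¬ P i (y i) := by
    filter_upwards [hn] with i hi
    push Not at hi
    exact Classical.epsilon_spec hi
  obtain ⟨i, h₁, h₂⟩ := ((h y ((hS y).2 (hy.mono fun _ h => h.1))).and hy).exists
  exact h₂.2 h₁

theorem IsInternal.eventually_nonempty {S : ∀ i, Set (α → Mi i)}
    {X : Set (α → (𝒰 : Filter I).Product Mi)} (hS : IsInternal (𝒰 : Filter I) S X)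
    (hX : X.Nonempty) : ∀ᶠ i in (𝒰 : Filter I), (S i).Nonempty := by
  obtain ⟨x, hx⟩ := hX
  obtain ⟨x, rfl⟩ := productTuple_surjective (𝒰 : Filter I) x
  exact ((hS x).1 hx).mono fun i hi => ⟨x i, hi⟩

theorem IsInternal.eventually_ncard_eq [Finite α] [∀ i, Finite (Mi i)] [∀ i, Nonempty (Mi i)]
    {S : ∀ i, Set (α → Mi i)} {X : Set (α → (𝒰 : Filter I).Product Mi)}
    (hS : IsInternal (𝒰 : Filter I) S X) (hX : X.Finite) :
    ∀ᶠ i in (𝒰 : Filter I), (S i).ncard = X.ncard := by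
  have hge : ∀ᶠ i in (𝒰 : Filter I), X.ncard ≤ (S i).ncard := by
    have := hX.fintype
    choose f hf using fun x : X => productTuple_surjective (𝒰 : Filter I) x.1
    have hmem : ∀ᶠ i in (𝒰 : Filter I), ∀ x, f x i ∈ S i :=
      Filter.eventually_all.2 fun x => (hS _).1 (by rw [hf]; exact x.2)
    have hinj : ∀ᶠ i in (𝒰 : Filter I), ∀ x y, x ≠ y → f x i ≠ f y i := by
      refine Filter.eventually_all.2 fun x => Filter.eventually_all.2 fun y => ?_
      by_cases hxy : x = y
      · simp [hxy]
      · have : ¬ ∀ᶠ i in (𝒰 : Filter I), f x i = f y i := by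
          rw [← productTuple_eq_iff, hf, hf]
          exact fun h => hxy (Subtype.ext h)
        exact (Ultrafilter.eventually_not.2 this).mono fun i hi _ => hi
    filter_upwards [hmem, hinj] with i h₁ h₂
    rw [← Nat.card_coe_set_eq, ← Nat.card_coe_set_eq]
    refine Nat.card_le_card_of_injective (fun x => (⟨f x i, h₁ x⟩ : S i)) fun x y hxy => ?_
    by_contra hne
    exact h₂ x y hne (congrArg Subtype.val hxy)
  have hle : ∀ᶠ i in (𝒰 : Filter I), (S i).ncard ≤ X.ncard := by
    by_contra hn
    rw [← Ultrafilter.eventually_not] at hn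
    let Q (i : I) (f : Fin (X.ncard + 1) → α → Mi i) : Prop :=
      Function.Injective f ∧ ∀ j, f j ∈ S i
    let f (i : I) : Fin (X.ncard + 1) → α → Mi i := Classical.epsilon (Q i)
    have hf : ∀ᶠ i in (𝒰 : Filter I), Q i (f i) := by
      filter_upwards [hn] with i hi
      refine Classical.epsilon_spec (p := Q i) ?_
      have := Fintype.ofFinite (S i)
      obtain ⟨e⟩ : Nonempty (Fin (X.ncard + 1) ↪ S i) := by
        rw [Function.Embedding.nonempty_iff_card_le, Fintype.card_fin, ← Nat.card_eq_fintype_card,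
          Nat.card_coe_set_eq]
        omega
      exact ⟨fun j => (e j).1, Subtype.val_injective.comp e.injective, fun j => (e j).2⟩
    let g (j : Fin (X.ncard + 1)) : X :=
      ⟨productTuple (𝒰 : Filter I) fun i => f i j, (hS _).2 (hf.mono fun i hi => hi.2 j)⟩
    have hg : Function.Injective g := by
      intro j k hjk
      have h := (productTuple_eq_iff _ _ _).1 (congrArg Subtype.val hjk)
      obtain ⟨i, h₁, h₂⟩ := (h.and hf).exists
      exact h₂.1 h₁
    have := hX.to_subtype
    have h := Nat.card_le_card_of_injective g hg
    rw [Nat.card_fin, Nat.card_coe_set_eq] at h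
    omega
  filter_upwards [hge, hle] with i h₁ h₂ using le_antisymm h₂ h₁

end Internal

/-- Double counting for a finite relation with constant fibre sizes. -/
theorem ncard_mul_eq_ncard_mul {α β : Type*} [Finite α] [Finite β] {X : Set α} {Y : Set β}
    {C : α → β → Prop} {k l : ℕ} (hC : ∀ x y, C x y → (x ∈ X ↔ y ∈ Y))
    (hk : ∀ x ∈ X, {y | C x y}.ncard = k) (hl : ∀ y ∈ Y, {x | C x y}.ncard = l) :
    X.ncard * k = Y.ncard * l := by
  classical
  have := Fintype.ofFinite α
  have := Fintype.ofFinite β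
  rw [Set.ncard_eq_toFinset_card', Set.ncard_eq_toFinset_card']
  refine Finset.card_mul_eq_card_mul C (fun x hx => ?_) fun y hy => ?_
  · rw [Set.mem_toFinset] at hx
    rw [← hk x hx, ← Set.ncard_coe_finset]
    congr 1
    ext y
    simp only [Finset.coe_bipartiteAbove, Set.mem_toFinset, Set.mem_ofPred_eq]
    exact ⟨fun h => h.2, fun h => ⟨(hC x y h).1 hx, h⟩⟩
  · rw [Set.mem_toFinset] at hy
    rw [← hl y hy, ← Set.ncard_coe_finset]
    congr 1
    ext x
    simp only [Finset.coe_bipartiteBelow, Set.mem_toFinset, Set.mem_ofPred_eq]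
    exact ⟨fun h => h.2, fun h => ⟨(hC x y h).2 hy, h⟩⟩

/-- A uniform definable correspondence between internal sets in an ultraproduct of finite
structures determines the ratio of the sizes of almost all of their components. -/
theorem IsDefUniformCorrespondence.eventually_ncard_mul_eq {L : FirstOrder.Language.{u, v}}
    {I : Type*} {Mi : I → Type w} [∀ i, L.Structure (Mi i)] [∀ i, Nonempty (Mi i)]
    [∀ i, Finite (Mi i)] {𝒰 : Ultrafilter I} {n m : ℕ}
    {X : Set (Fin n → (𝒰 : Filter I).Product Mi)} {Y : Set (Fin m → (𝒰 : Filter I).Product Mi)}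
    {S : ∀ i, Set (Fin n → Mi i)} {T : ∀ i, Set (Fin m → Mi i)}
    (hS : IsInternal (𝒰 : Filter I) S X) (hT : IsInternal (𝒰 : Filter I) T Y)
    {C : Set ((Fin n → (𝒰 : Filter I).Product Mi) × (Fin m → (𝒰 : Filter I).Product Mi))}
    {k l : ℕ} (hC : IsDefUniformCorrespondence L X Y C k l) :
    ∀ᶠ i in (𝒰 : Filter I), (S i).ncard * k = (T i).ncard * l := by
  obtain ⟨R, hR⟩ := exists_isInternal_of_definable 𝒰 hC.definable
  have hmem (x : ∀ i, Fin n → Mi i) (y : ∀ i, Fin m → Mi i) :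
      (productTuple (𝒰 : Filter I) x, productTuple (𝒰 : Filter I) y) ∈ C ↔
        ∀ᶠ i in (𝒰 : Filter I), Sum.elim (x i) (y i) ∈ R i :=
    hR fun i => Sum.elim (x i) (y i)
  have hsub : ∀ᶠ i in (𝒰 : Filter I), ∀ z ∈ R i, z ∘ Sum.inl ∈ S i ∧ z ∘ Sum.inr ∈ T i := by
    refine hR.eventually_forall fun z hz => ?_
    have h := hC.subset hz
    exact ((hS fun i => z i ∘ Sum.inl).1 h.1).and ((hT fun i => z i ∘ Sum.inr).1 h.2)
  have hk : ∀ᶠ i in (𝒰 : Filter I), ∀ x ∈ S i, {y | Sum.elim x y ∈ R i}.ncard = k := by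
    refine hS.eventually_forall fun x hx => ?_
    rw [← hC.fiber_card _ hx]
    exact IsInternal.eventually_ncard_eq (fun y => hmem x y) (hC.finite_fibers _ hx)
  have hl : ∀ᶠ i in (𝒰 : Filter I), ∀ y ∈ T i, {x | Sum.elim x y ∈ R i}.ncard = l := by
    refine hT.eventually_forall fun y hy => ?_
    rw [← hC.cofiber_card _ hy]
    exact IsInternal.eventually_ncard_eq (fun x => hmem x y) (hC.finite_cofibers _ hy)
  filter_upwards [hsub, hk, hl] with i h₁ h₂ h₃
  refine ncard_mul_eq_ncard_mul (C := fun x y => Sum.elim x y ∈ R i) (fun x y h => ?_) h₂ h₃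
  exact iff_of_true (h₁ _ h).1 (h₁ _ h).2

/-- In an ultraproduct of nonempty finite structures, every uniform definable
correspondence between a definable set and itself is balanced; consequently any two uniform
definable correspondences between two definable sets have the same ratio. -/
theorem statement13 (L : FirstOrder.Language.{u, v}) {I : Type*} (Mi : I → Type w)
    [∀ i, L.Structure (Mi i)] (hne : ∀ i, Nonempty (Mi i)) (hfin : ∀ i, Finite (Mi i))
    (𝒰 : Ultrafilter I) :
    (∀ (n : ℕ) (X : Set (Fin n → (↑𝒰 : Filter I).Product Mi)),
      (Set.univ : Set ((↑𝒰 : Filter I).Product Mi)).Definable L X →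
      ∀ (C : Set ((Fin n → (↑𝒰 : Filter I).Product Mi) ×
          (Fin n → (↑𝒰 : Filter I).Product Mi))) (k ℓ : ℕ),
        IsDefUniformCorrespondence L X X C k ℓ → k = ℓ) ∧
    (∀ (n m : ℕ) (X : Set (Fin n → (↑𝒰 : Filter I).Product Mi))
        (Y : Set (Fin m → (↑𝒰 : Filter I).Product Mi)),
      (Set.univ : Set ((↑𝒰 : Filter I).Product Mi)).Definable L X →
      (Set.univ : Set ((↑𝒰 : Filter I).Product Mi)).Definable L Y →
      ∀ (C₁ C₂ : Set ((Fin n → (↑𝒰 : Filter I).Product Mi) ×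
          (Fin m → (↑𝒰 : Filter I).Product Mi))) (k₁ ℓ₁ k₂ ℓ₂ : ℕ),
        IsDefUniformCorrespondence L X Y C₁ k₁ ℓ₁ →
        IsDefUniformCorrespondence L X Y C₂ k₂ ℓ₂ →
        (k₁ : ℚ) / (ℓ₁ : ℚ) = (k₂ : ℚ) / (ℓ₂ : ℚ)) := by
  have key {n m : ℕ} {X : Set (Fin n → (↑𝒰 : Filter I).Product Mi)}
      {Y : Set (Fin m → (↑𝒰 : Filter I).Product Mi)}
      {S : ∀ i, Set (Fin n → Mi i)} {T : ∀ i, Set (Fin m → Mi i)}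
      (hS : IsInternal (𝒰 : Filter I) S X) (hT : IsInternal (𝒰 : Filter I) T Y)
      {C : Set ((Fin n → (↑𝒰 : Filter I).Product Mi) × (Fin m → (↑𝒰 : Filter I).Product Mi))}
      {k l : ℕ} (hC : IsDefUniformCorrespondence L X Y C k l) :
      ∀ᶠ i in (𝒰 : Filter I), 0 < (S i).ncard ∧ (k : ℚ) / l = (T i).ncard / (S i).ncard := by
    obtain ⟨p, hp⟩ := hC.nonempty
    filter_upwards [hC.eventually_ncard_mul_eq hS hT,
      hS.eventually_nonempty ⟨p.1, (hC.subset hp).1⟩] with i h hne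
    have hpos : 0 < (S i).ncard := hne.ncard_pos (Set.toFinite _)
    refine ⟨hpos, ?_⟩
    have hl := hC.l_pos
    rw [div_eq_div_iff (by positivity) (by positivity), mul_comm (k : ℚ)]
    exact_mod_cast h
  refine ⟨fun n X hX C k l hC => ?_, fun n m X Y hX hY C₁ C₂ k₁ l₁ k₂ l₂ h₁ h₂ => ?_⟩
  · obtain ⟨S, hS⟩ := exists_isInternal_of_definable 𝒰 hX
    obtain ⟨i, hpos, h⟩ := (key hS hS hC).exists
    have hl := hC.l_pos
    rw [div_self (by positivity), div_eq_one_iff_eq (by positivity)] at h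
    exact_mod_cast h
  · obtain ⟨S, hS⟩ := exists_isInternal_of_definable 𝒰 hX
    obtain ⟨T, hT⟩ := exists_isInternal_of_definable 𝒰 hY
    obtain ⟨i, h, h'⟩ := ((key hS hT h₁).and (key hS hT h₂)).exists
    exact h.2.trans h'.2.symm

end Unimod
end

section
/- Let M be the structure whose universe is the set 2^{<ω} of all finite binary strings, in the language with a single binary relation symbol S interpreted by: S(a,b) holds if and only if b = a⌢0 or b = a⌢1. Then for every string a and each i ∈ {0,1}: (1) a⌢0 ≡_{\{a\}} a⌢1, and the set of realizations in M of the complete type tp(a⌢i/{a}) is exactly {a⌢0, a⌢1}, so it has exactly 2 elements; (2) the set of realizations in M of the complete type tp(a/{a⌢i}) is exactly {a}, so it has exactly 1 element. In particular, a and a⌢i are interalgebraic over ∅ with m(a⌢i/{a}) = 2 ≠ 1 = m(a/{a⌢i}). -/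
open FirstOrder Set

namespace Unimod

universe u v w

variable (L : FirstOrder.Language.{u, v}) {M : Type w} [L.Structure M]

/-- The language with a single binary relation symbol `S`. -/
def L14 : FirstOrder.Language where
  Functions := fun _ => Empty
  Relations := fun n => match n with
    | 2 => Unit
    | _ => Empty

/-- The structure on the set of finite binary strings where `S(a,b)` holds iff `b = a⌢0` or
`b = a⌢1`. -/
instance L14Structure : L14.Structure (List Bool) where
  funMap := fun f _ => f.elim
  RelMap := fun {n} r v =>
    match n, r, v with
    | 2, _, v => v 1 = (v 0).concat false ∨ v 1 = (v 0).concat true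

/-- The symbol `S` of `L14`. -/
def successorSymbol : L14.Relations 2 := ()

theorem relMap_successorSymbol (v : Fin 2 → List Bool) :
    FirstOrder.Language.Structure.RelMap (L := L14) successorSymbol v ↔
      v 1 = (v 0).concat false ∨ v 1 = (v 0).concat true :=
  Iff.rfl

theorem exists_concat_iff (b c : List Bool) :
    (c = b.concat false ∨ c = b.concat true) ↔ ∃ x, c = b.concat x := by
  simp

theorem sameType_of_equiv_s14 {L : FirstOrder.Language.{u, v}} {M : Type w} [L.Structure M]
    {A : Set M} {α : Type*} {a b : α → M} (σ : M ≃[L] M) (hA : ∀ x ∈ A, σ x = x)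
    (hab : ∀ j, σ (a j) = b j) : SameType L A a b := by
  intro φ
  have h : Sum.elim (fun x : A => (x : M)) b = σ ∘ Sum.elim (fun x : A => (x : M)) a := by
    funext j
    rcases j with x | j
    · exact (hA x x.2).symm
    · exact (hab j).symm
  rw [h, FirstOrder.Language.StrongHomClass.realize_formula]

theorem SameType.relMap_iff {L : FirstOrder.Language.{u, v}} {M : Type w} [L.Structure M]
    {A : Set M} {α : Type*} {a b : α → M} (h : SameType L A a b) {n : ℕ} (R : L.Relations n)
    (t : Fin n → A ⊕ α) :
    FirstOrder.Language.Structure.RelMap R (fun j => Sum.elim (fun x : A => (x : M)) a (t j)) ↔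
      FirstOrder.Language.Structure.RelMap R
        (fun j => Sum.elim (fun x : A => (x : M)) b (t j)) := by
  simpa [FirstOrder.Language.Formula.realize_rel] using
    h (R.formula fun j => FirstOrder.Language.Term.var (t j))

/-- Flip the bit at index `n`, if there is one. -/
def flipBit (n : ℕ) (l : List Bool) : List Bool := l.modify n not

theorem flipBit_flipBit (n : ℕ) (l : List Bool) : flipBit n (flipBit n l) = l := by
  induction l generalizing n with
  | nil => simp [flipBit]
  | cons x l ih => cases n <;> simp_all [flipBit]

theorem flipBit_of_length_le {n : ℕ} {l : List Bool} (h : l.length ≤ n) : flipBit n l = l :=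
  List.modify_eq_self h

theorem flipBit_length_concat (l : List Bool) (x : Bool) :
    flipBit l.length (l.concat x) = l.concat (!x) := by
  induction l with
  | nil => simp [flipBit]
  | cons y l ih => simpa [flipBit] using ih

theorem exists_flipBit_concat (n : ℕ) (l : List Bool) (x : Bool) :
    ∃ y, flipBit n (l.concat x) = (flipBit n l).concat y := by
  induction l generalizing n with
  | nil => cases n <;> simp [flipBit]
  | cons z l ih => cases n <;> simp_all [flipBit]

/-- Flipping the bit at index `n` is an automorphism of the binary tree. -/
def flipEquiv (n : ℕ) : List Bool ≃[L14] List Bool where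
  toFun := flipBit n
  invFun := flipBit n
  left_inv := flipBit_flipBit n
  right_inv := flipBit_flipBit n
  map_fun' := fun f => f.elim
  map_rel' := by
    intro k r v
    match k, r with
    | 2, r =>
      change (flipBit n (v 1) = (flipBit n (v 0)).concat false ∨
        flipBit n (v 1) = (flipBit n (v 0)).concat true) ↔
        (v 1 = (v 0).concat false ∨ v 1 = (v 0).concat true)
      rw [exists_concat_iff, exists_concat_iff]
      constructor
      · rintro ⟨x, hx⟩
        obtain ⟨y, hy⟩ := exists_flipBit_concat n (flipBit n (v 0)) x
        rw [← hx, flipBit_flipBit, flipBit_flipBit] at hy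
        exact ⟨y, hy⟩
      · rintro ⟨x, hx⟩
        rw [hx]
        exact exists_flipBit_concat n (v 0) x

theorem sameType_concat_not (a : List Bool) (x : Bool) :
    SameType L14 ({a} : Set (List Bool))
      (fun _ : Fin 1 => a.concat x) (fun _ : Fin 1 => a.concat (!x)) := by
  refine sameType_of_equiv_s14 (flipEquiv a.length) ?_ fun _ => flipBit_length_concat a x
  rintro _ rfl
  exact flipBit_of_length_le le_rfl

theorem typeSet_concat (a : List Bool) (i : Bool) :
    typeSet L14 ({a} : Set (List Bool)) (fun _ : Fin 1 => a.concat i) =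
      {fun _ : Fin 1 => a.concat false, fun _ : Fin 1 => a.concat true} := by
  ext b
  constructor
  · intro hb
    have h := (SameType.relMap_iff hb successorSymbol
      ![Sum.inl ⟨a, rfl⟩, Sum.inr 0]).mp
        ((exists_concat_iff a (a.concat i)).mpr ⟨i, rfl⟩)
    have h' : b 0 = a.concat false ∨ b 0 = a.concat true := h
    refine h'.imp (fun h => ?_) fun h => ?_ <;>
    · funext j
      rw [Subsingleton.elim j 0, h]
  · have hr : ∀ x, SameType L14 ({a} : Set (List Bool))
        (fun _ : Fin 1 => a.concat x) (fun _ : Fin 1 => a.concat x) := fun _ _ => Iff.rfl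
    rintro (rfl | rfl) <;> cases i
    exacts [hr _, sameType_concat_not a true, sameType_concat_not a false, hr _]

theorem typeSet_parent (a : List Bool) (i : Bool) :
    typeSet L14 ({a.concat i} : Set (List Bool)) (fun _ : Fin 1 => a) =
      {fun _ : Fin 1 => a} := by
  ext b
  constructor
  · intro hb
    have h : a.concat i = (b 0).concat false ∨ a.concat i = (b 0).concat true :=
      (SameType.relMap_iff hb successorSymbol
        ![Sum.inr 0, Sum.inl ⟨a.concat i, rfl⟩]).mp
          ((exists_concat_iff a (a.concat i)).mpr ⟨i, rfl⟩)
    have h' : a = b 0 := by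
      rcases h with h | h <;> simp at h <;> exact h.1
    funext j
    rw [Subsingleton.elim j 0, ← h']
  · rintro rfl
    exact fun _ => Iff.rfl

/-- in the binary tree structure, for every string `a` and bit `i`:
`a⌢0 ≡_{a} a⌢1`, the type of `a⌢i` over `{a}` has realization set `{a⌢0, a⌢1}` (of size 2),
the type of `a` over `{a⌢i}` has realization set `{a}` (of size 1); in particular `a` and
`a⌢i` are interalgebraic over `∅` with `m(a⌢i/{a}) = 2 ≠ 1 = m(a/{a⌢i})`. -/
theorem statement14 (a : List Bool) (i : Bool) :
    SameType L14 ({a} : Set (List Bool))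
      (fun _ : Fin 1 => a.concat false) (fun _ : Fin 1 => a.concat true) ∧
    typeSet L14 ({a} : Set (List Bool)) (fun _ : Fin 1 => a.concat i) =
      {fun _ : Fin 1 => a.concat false, fun _ : Fin 1 => a.concat true} ∧
    (typeSet L14 ({a} : Set (List Bool)) (fun _ : Fin 1 => a.concat i)).ncard = 2 ∧
    typeSet L14 ({a.concat i} : Set (List Bool)) (fun _ : Fin 1 => a) =
      {fun _ : Fin 1 => a} ∧
    (typeSet L14 ({a.concat i} : Set (List Bool)) (fun _ : Fin 1 => a)).ncard = 1 ∧
    (typeSet L14 ({a.concat i} : Set (List Bool)) (fun _ : Fin 1 => a)).Finite ∧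
    (typeSet L14 ({a} : Set (List Bool)) (fun _ : Fin 1 => a.concat i)).Finite ∧
    (2 : ℕ) ≠ 1 := by
  refine ⟨sameType_concat_not a false, typeSet_concat a i, ?_, typeSet_parent a i, ?_, ?_, ?_,
    by decide⟩
  · rw [typeSet_concat, Set.ncard_pair]
    intro h
    simpa using congrFun h 0
  · rw [typeSet_parent, Set.ncard_singleton]
  · rw [typeSet_parent]
    exact Set.finite_singleton _
  · rw [typeSet_concat]
    exact Set.toFinite _

end Unimod
end

section
/- For each integer n ≥ 1, let M_n be the finite L-structure, in the language L with unary predicate symbols R_i (i ∈ ℕ) and a unary function symbol f, whose universe is the set 2^{<n} of binary strings of length < n, where R_i^{M_n} = {η : length(η) = n − i} for 1 ≤ i ≤ n and R_i^{M_n} = ∅ otherwise, and f^{M_n}(η) is η with its last bit removed if η is nonempty and f^{M_n}(∅) = ∅. Let 𝒰 be a non-principal ultrafilter on the positive integers and M = ∏_𝒰 M_n the ultraproduct. Let Q = {x ∈ M : x ∉ R_i^M for every i ∈ ℕ, and f^{j+1}(x) ≠ f^j(x) for every j ≥ 0}. Then: (1) Q is nonempty and type-definable over ∅; (2) f(Q)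 = Q; (3) for every y ∈ Q, the set {x ∈ M : f(x) = y} has exactly two elements, and both belong to Q. Consequently, C = {(x,y) ∈ Q × Q : f(x) = y} is a uniform correspondence over ∅ between Q and Q with k_C = 1 and ℓ_C = 2, so Q is not measurable over ∅. -/
open FirstOrder Set

namespace Unimod

universe u v w

variable (L : FirstOrder.Language.{u, v}) {M : Type w} [L.Structure M]

/-- The language with unary predicate symbols `R_i` (`i ∈ ℕ`) and one unary function
symbol `f`. -/
def L15 : FirstOrder.Language where
  Functions := fun n => match n with
    | 1 => Unit
    | _ => Empty
  Relations := fun n => match n with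
    | 1 => ℕ
    | _ => Empty

/-- The function symbol `f` of `L15`. -/
def fSym : L15.Functions 1 := Unit.unit

/-- The relation symbol `R_i` of `L15`. -/
def rSym (i : ℕ) : L15.Relations 1 := i

/-- The universe of the finite structure `M_n`: binary strings of length `< n`. -/
def Str (n : ℕ) : Type := {l : List Bool // l.length < n}

/-- The `L15`-structure `M_n`: `R_i` holds of the strings of length `n - i` (for
`1 ≤ i ≤ n`), and `f` removes the last bit (fixing the empty string). -/
instance L15Structure (n : ℕ) : L15.Structure (Str n) where
  funMap := fun {k} f v =>
    match k, f, v with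
    | 1, _, v => ⟨(v 0).1.dropLast,
        lt_of_le_of_lt (by rw [List.length_dropLast]; exact Nat.sub_le _ _) (v 0).2⟩
    | 0, f, _ => f.elim
    | (_ + 2), f, _ => f.elim
  RelMap := fun {k} r v =>
    match k, r, v with
    | 1, i, v =>
        1 ≤ (show ℕ from i) ∧ (show ℕ from i) ≤ n ∧ (v 0).1.length = n - (show ℕ from i)
    | 0, r, _ => r.elim
    | (_ + 2), r, _ => r.elim

/-- The ultraproduct `M = ∏_𝒰 M_n` over an ultrafilter on the positive integers. -/
abbrev UltraM (𝒰 : Ultrafilter {n : ℕ // 1 ≤ n}) : Type :=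
  (↑𝒰 : Filter {n : ℕ // 1 ≤ n}).Product fun i => Str i.1

/-- The interpretation of the function symbol `f` in the ultraproduct. -/
def fApp {𝒰 : Ultrafilter {n : ℕ // 1 ≤ n}} (x : UltraM 𝒰) : UltraM 𝒰 :=
  FirstOrder.Language.Structure.funMap (L := L15) fSym fun _ : Fin 1 => x

/-- The interpretation of the relation symbol `R_i` in the ultraproduct. -/
def inRel {𝒰 : Ultrafilter {n : ℕ // 1 ≤ n}} (i : ℕ) (x : UltraM 𝒰) : Prop :=
  FirstOrder.Language.Structure.RelMap (L := L15) (rSym i) fun _ : Fin 1 => x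

/-- The set `Q`: elements in no `R_i` on which all iterates of `f` keep moving. -/
def Q (𝒰 : Ultrafilter {n : ℕ // 1 ≤ n}) : Set (UltraM 𝒰) :=
  {x | (∀ i : ℕ, ¬ inRel i x) ∧ ∀ j : ℕ, fApp^[j + 1] x ≠ fApp^[j] x}

/-- Removal of the last bit of a binary string. -/
def Str.trunc {n : ℕ} (x : Str n) : Str n :=
  ⟨x.1.dropLast, lt_of_le_of_lt (by rw [List.length_dropLast]; exact Nat.sub_le _ _) x.2⟩

/-- Appending the bit `b` at the end of a string, whenever the result is short enough. -/
def Str.snoc {n : ℕ} (b : Bool) (x : Str n) : Str n :=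
  if h : x.1.length + 1 < n then ⟨x.1 ++ [b], by simpa using h⟩ else x

theorem Str.val_snoc {n : ℕ} (b : Bool) {x : Str n} (h : x.1.length + 1 < n) :
    (x.snoc b).1 = x.1 ++ [b] := by
  simp [Str.snoc, h]

theorem Str.trunc_snoc {n : ℕ} (b : Bool) {x : Str n} (h : x.1.length + 1 < n) :
    (x.snoc b).trunc = x := by
  apply Subtype.ext
  simp [Str.trunc, Str.val_snoc b h]

theorem Str.eq_snoc_of_trunc_eq {n : ℕ} {x y : Str n} (hy : 0 < y.1.length)
    (hn : y.1.length + 1 < n) (h : x.trunc = y) : x = y.snoc true ∨ x = y.snoc false := by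
  have hv : x.1.dropLast = y.1 := congrArg Subtype.val h
  have hx : x.1 ≠ [] := by
    intro h0
    rw [h0, List.dropLast_nil] at hv
    simp [← hv] at hy
  have hx' : x.1 = y.1 ++ [x.1.getLast hx] := by
    rw [← hv, List.dropLast_append_getLast]
  cases hb : x.1.getLast hx with
  | true => exact Or.inl (Subtype.ext (by rw [Str.val_snoc _ hn, hx', hb]))
  | false => exact Or.inr (Subtype.ext (by rw [Str.val_snoc _ hn, hx', hb]))

theorem Str.length_trunc {n : ℕ} (x : Str n) : x.trunc.1.length = x.1.length - 1 :=
  List.length_dropLast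

theorem Str.length_trunc_iterate {n : ℕ} (j : ℕ) (x : Str n) :
    (Str.trunc^[j] x).1.length = x.1.length - j := by
  induction j with
  | zero => rfl
  | succ j ih => rw [Function.iterate_succ_apply', Str.length_trunc, ih, Nat.sub_sub]

theorem Str.trunc_eq_self_iff {n : ℕ} (x : Str n) : x.trunc = x ↔ x.1.length = 0 := by
  constructor
  · intro h
    have := congrArg (fun z : Str n => z.1.length) h
    simp only [Str.length_trunc] at this
    omega
  · intro h
    apply Subtype.ext
    simp [Str.trunc, List.length_eq_zero_iff.1 h]

theorem Str.trunc_iterate_succ_eq_iff {n : ℕ} (j : ℕ) (x : Str n) :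
    Str.trunc^[j + 1] x = Str.trunc^[j] x ↔ x.1.length ≤ j := by
  rw [Function.iterate_succ_apply', Str.trunc_eq_self_iff, Str.length_trunc_iterate]
  omega

section Ultraproduct

variable {𝒰 : Ultrafilter {n : ℕ // 1 ≤ n}}

/-- The element of the ultraproduct represented by a sequence. -/
def UltraM.mk (𝒰 : Ultrafilter {n : ℕ // 1 ≤ n}) (s : ∀ i : {n : ℕ // 1 ≤ n}, Str i.1) :
    UltraM 𝒰 :=
  Quotient.mk'' s

theorem UltraM.exists_mk (x : UltraM 𝒰) : ∃ s, UltraM.mk 𝒰 s = x :=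
  Quotient.exists_rep x

theorem UltraM.mk_eq_mk {s t : ∀ i : {n : ℕ // 1 ≤ n}, Str i.1} :
    UltraM.mk 𝒰 s = UltraM.mk 𝒰 t ↔ ∀ᶠ i in (𝒰 : Filter _), s i = t i :=
  Quotient.eq''

theorem fApp_mk (s : ∀ i : {n : ℕ // 1 ≤ n}, Str i.1) :
    fApp (UltraM.mk 𝒰 s) = UltraM.mk 𝒰 fun i => (s i).trunc :=
  FirstOrder.Language.Ultraproduct.funMap_cast (L := L15) (u := 𝒰) fSym fun _ : Fin 1 => s

theorem fApp_iterate_mk (j : ℕ) (s : ∀ i : {n : ℕ // 1 ≤ n}, Str i.1) :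
    fApp^[j] (UltraM.mk 𝒰 s) = UltraM.mk 𝒰 fun i => Str.trunc^[j] (s i) := by
  induction j with
  | zero => rfl
  | succ j ih => simp only [Function.iterate_succ_apply', ih, fApp_mk]

theorem inRel_mk (k : ℕ) (s : ∀ i : {n : ℕ // 1 ≤ n}, Str i.1) :
    inRel k (UltraM.mk 𝒰 s) ↔
      ∀ᶠ i in (𝒰 : Filter _), 1 ≤ k ∧ k ≤ i.1 ∧ (s i).1.length = i.1 - k :=
  FirstOrder.Language.relMap_quotient_mk' (L := L15)
    (s := (𝒰 : Filter {n : ℕ // 1 ≤ n}).productSetoid fun i => Str i.1)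
    (ps := FirstOrder.Language.Ultraproduct.setoidPrestructure _ 𝒰) (rSym k) fun _ : Fin 1 => s

theorem eventually_lt_of_nonprincipal (hU : ∀ i, {i} ∉ 𝒰) (k : ℕ) :
    ∀ᶠ i in (𝒰 : Filter {n : ℕ // 1 ≤ n}), k < i.1 := by
  have hfin : {i : {n : ℕ // 1 ≤ n} | i.1 ≤ k}.Finite :=
    (Set.finite_Iic k).preimage Subtype.val_injective.injOn
  by_contra h
  rw [← Ultrafilter.eventually_not] at h
  have h' : {i : {n : ℕ // 1 ≤ n} | i.1 ≤ k} ∈ 𝒰 := by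
    filter_upwards [h] with i hi using not_lt.1 hi
  obtain ⟨i, -, hi⟩ := Ultrafilter.eq_pure_of_finite_mem hfin h'
  exact hU i (by rw [hi]; exact Set.mem_singleton i)

theorem mk_mem_Q_iff (s : ∀ i : {n : ℕ // 1 ≤ n}, Str i.1) :
    UltraM.mk 𝒰 s ∈ Q 𝒰 ↔
      ∀ k : ℕ, ∀ᶠ i in (𝒰 : Filter _), k < (s i).1.length ∧ (s i).1.length + k < i.1 := by
  have hrel : ∀ k, ¬ inRel k (UltraM.mk 𝒰 s) ↔
      ∀ᶠ i in (𝒰 : Filter _), (s i).1.length + k ≠ i.1 := by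
    intro k
    rw [inRel_mk, ← Ultrafilter.eventually_not]
    refine Filter.eventually_congr (Filter.Eventually.of_forall fun i => ?_)
    have := (s i).2
    omega
  have hmove : ∀ j, fApp^[j + 1] (UltraM.mk 𝒰 s) ≠ fApp^[j] (UltraM.mk 𝒰 s) ↔
      ∀ᶠ i in (𝒰 : Filter _), j < (s i).1.length := by
    intro j
    rw [ne_eq, fApp_iterate_mk, fApp_iterate_mk, UltraM.mk_eq_mk, ← Ultrafilter.eventually_not]
    simp only [Str.trunc_iterate_succ_eq_iff, not_le]
  simp only [Q, Set.mem_ofPred_eq, hrel, hmove, Filter.eventually_and, forall_and]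
  rw [and_comm]
  refine and_congr_right fun _ => ⟨fun h k => ?_, fun h k => ?_⟩
  · induction k with
    | zero => exact Filter.Eventually.of_forall fun i => (s i).2
    | succ k ih =>
      filter_upwards [ih, h (k + 1)] with i h1 h2
      omega
  · filter_upwards [h k] with i hi using hi.ne

theorem Q_nonempty (hU : ∀ i, {i} ∉ 𝒰) : (Q 𝒰).Nonempty := by
  refine ⟨UltraM.mk 𝒰 fun i => ⟨List.replicate (i.1 / 2) true, ?_⟩,
    (mk_mem_Q_iff _).2 fun k => ?_⟩
  · have := i.2
    rw [List.length_replicate]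
    omega
  · filter_upwards [eventually_lt_of_nonprincipal hU (2 * k + 2)] with i hi
    simp only [List.length_replicate]
    omega

theorem fApp_mem_Q_iff (x : UltraM 𝒰) : fApp x ∈ Q 𝒰 ↔ x ∈ Q 𝒰 := by
  obtain ⟨s, rfl⟩ := x.exists_mk
  rw [fApp_mk, mk_mem_Q_iff, mk_mem_Q_iff]
  constructor <;> intro h k <;> filter_upwards [h (k + 1)] with i hi <;>
    rw [Str.length_trunc] at * <;> omega

theorem ncard_fApp_fiber {y : UltraM 𝒰} (hy : y ∈ Q 𝒰) : {x | fApp x = y}.ncard = 2 := by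
  obtain ⟨s, rfl⟩ := y.exists_mk
  rw [mk_mem_Q_iff] at hy
  have hfib : {x | fApp x = UltraM.mk 𝒰 s} =
      {UltraM.mk 𝒰 fun i => (s i).snoc true, UltraM.mk 𝒰 fun i => (s i).snoc false} := by
    ext x
    obtain ⟨t, rfl⟩ := x.exists_mk
    simp only [Set.mem_ofPred_eq, Set.mem_insert_iff, Set.mem_singleton_iff, fApp_mk,
      UltraM.mk_eq_mk, ← Ultrafilter.eventually_or]
    constructor
    · intro h
      filter_upwards [h, hy 1] with i hi hyi
      exact Str.eq_snoc_of_trunc_eq (by omega) hyi.2 hi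
    · intro h
      filter_upwards [h, hy 1] with i hi hyi
      rcases hi with hi | hi <;> rw [hi, Str.trunc_snoc _ hyi.2]
  rw [hfib]
  refine Set.ncard_pair fun h => ?_
  rw [UltraM.mk_eq_mk] at h
  obtain ⟨i, hi, hyi⟩ := (h.and (hy 1)).exists
  have := congrArg Subtype.val hi
  simp [Str.val_snoc _ hyi.2] at this

theorem fApp_image_Q : fApp '' Q 𝒰 = Q 𝒰 := by
  apply Set.Subset.antisymm
  · rintro _ ⟨x, hx, rfl⟩
    exact (fApp_mem_Q_iff x).2 hx
  · intro y hy
    have hne : {x | fApp x = y}.Nonempty :=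
      Set.nonempty_of_ncard_ne_zero (by rw [ncard_fApp_fiber hy]; decide)
    obtain ⟨x, rfl⟩ := hne
    exact ⟨x, (fApp_mem_Q_iff x).1 hy, rfl⟩

theorem exists_term_realize_eq_fApp_iterate {α : Type*} (a : α) (j : ℕ) :
    ∃ t : L15.Term α, ∀ v : α → UltraM 𝒰, t.realize v = fApp^[j] (v a) := by
  induction j with
  | zero => exact ⟨FirstOrder.Language.Term.var a, fun v => rfl⟩
  | succ j ih =>
    obtain ⟨t, ht⟩ := ih
    refine ⟨FirstOrder.Language.Term.func fSym fun _ => t, fun v => ?_⟩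
    rw [Function.iterate_succ_apply', ← ht]
    rfl

theorem definable_inRel {α : Type*} (a : α) (k : ℕ) :
    (∅ : Set (UltraM 𝒰)).Definable L15 {v : α → UltraM 𝒰 | inRel k (v a)} := by
  rw [Set.empty_definable_iff]
  refine ⟨(rSym k).formula fun _ => FirstOrder.Language.Term.var a, ?_⟩
  ext v
  exact (FirstOrder.Language.Formula.realize_rel (R := rSym k)
    (ts := fun _ => FirstOrder.Language.Term.var a) (v := v)).symm

theorem definable_fApp_iterate_eq {α : Type*} (a b : α) (j k : ℕ) :
    (∅ : Set (UltraM 𝒰)).Definable L15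
      {v : α → UltraM 𝒰 | fApp^[j] (v a) = fApp^[k] (v b)} := by
  rw [Set.empty_definable_iff]
  obtain ⟨t, ht⟩ := exists_term_realize_eq_fApp_iterate (𝒰 := 𝒰) a j
  obtain ⟨u, hu⟩ := exists_term_realize_eq_fApp_iterate (𝒰 := 𝒰) b k
  refine ⟨t.equal u, ?_⟩
  ext v
  exact (by rw [FirstOrder.Language.Formula.realize_equal, ht, hu] :
    (t.equal u).Realize v ↔ fApp^[j] (v a) = fApp^[k] (v b)).symm

end Ultraproduct

theorem TypeDefinable.inter {A : Set M} {α : Type*} {s t : Set (α → M)}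
    (hs : TypeDefinable L A s) (ht : TypeDefinable L A t) : TypeDefinable L A (s ∩ t) := by
  obtain ⟨S, hS, rfl⟩ := hs
  obtain ⟨T, hT, rfl⟩ := ht
  exact ⟨S ∪ T, fun u hu => hu.elim (hS u) (hT u), (Set.sInter_union S T).symm⟩

theorem typeDefinable_of_definable {A : Set M} {α : Type*} {s : Set (α → M)}
    (hs : A.Definable L s) : TypeDefinable L A s :=
  ⟨{s}, by simpa using hs, by simp⟩

theorem typeDefinable_iInter_of_definable {A : Set M} {α ι : Type*} {s : ι → Set (α → M)}
    (hs : ∀ i, A.Definable L (s i)) : TypeDefinable L A (⋂ i, s i) :=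
  ⟨Set.range s, by rintro _ ⟨i, rfl⟩; exact hs i, (Set.sInter_range s).symm⟩

theorem typeDefinable_mem_Q {𝒰 : Ultrafilter {n : ℕ // 1 ≤ n}} {α : Type*} (a : α) :
    TypeDefinable L15 (∅ : Set (UltraM 𝒰)) {v : α → UltraM 𝒰 | v a ∈ Q 𝒰} := by
  have h : {v : α → UltraM 𝒰 | v a ∈ Q 𝒰} =
      (⋂ k, {v : α → UltraM 𝒰 | inRel k (v a)}ᶜ) ∩
        ⋂ j, {v : α → UltraM 𝒰 | fApp^[j + 1] (v a) = fApp^[j] (v a)}ᶜ := by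
    ext v
    simp [Q]
  rw [h]
  exact TypeDefinable.inter L15
    (typeDefinable_iInter_of_definable L15 fun k => (definable_inRel a k).compl)
    (typeDefinable_iInter_of_definable L15 fun j =>
      (definable_fApp_iterate_eq a a (j + 1) j).compl)

/-- The graph of `f` on `Q` is a uniform correspondence of ratio `1 / 2`. -/
theorem isUniformCorrespondence_fApp {𝒰 : Ultrafilter {n : ℕ // 1 ≤ n}}
    (hU : ∀ i, {i} ∉ 𝒰) :
    IsUniformCorrespondence L15 (∅ : Set (UltraM 𝒰))
      {v : Fin 1 → UltraM 𝒰 | v 0 ∈ Q 𝒰} {v : Fin 1 → UltraM 𝒰 | v 0 ∈ Q 𝒰}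
      {p : (Fin 1 → UltraM 𝒰) × (Fin 1 → UltraM 𝒰) |
        p.1 0 ∈ Q 𝒰 ∧ p.2 0 ∈ Q 𝒰 ∧ fApp (p.1 0) = p.2 0} 1 2 := by
  have hfib : ∀ x ∈ {v : Fin 1 → UltraM 𝒰 | v 0 ∈ Q 𝒰},
      {y : Fin 1 → UltraM 𝒰 | x 0 ∈ Q 𝒰 ∧ y 0 ∈ Q 𝒰 ∧ fApp (x 0) = y 0}.ncard = 1 := by
    intro x hx
    rw [Set.ncard_eq_one]
    refine ⟨fun _ => fApp (x 0), ?_⟩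
    ext y
    simp only [Set.mem_ofPred_eq, Set.mem_singleton_iff, funext_iff, Fin.forall_fin_one]
    exact ⟨fun h => h.2.2.symm, fun h => ⟨hx, h ▸ (fApp_mem_Q_iff _).2 hx, h.symm⟩⟩
  have hcofib : ∀ y ∈ {v : Fin 1 → UltraM 𝒰 | v 0 ∈ Q 𝒰},
      {x : Fin 1 → UltraM 𝒰 | x 0 ∈ Q 𝒰 ∧ y 0 ∈ Q 𝒰 ∧ fApp (x 0) = y 0}.ncard = 2 := by
    intro y hy
    rw [← ncard_fApp_fiber hy]
    refine Set.ncard_congr (fun x _ => x 0) (fun x hx => hx.2.2) ?_ ?_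
    · intro x x' _ _ h
      funext i
      rwa [Subsingleton.elim i 0]
    · intro z hz
      have hz' : fApp z = y 0 := hz
      exact ⟨fun _ => z, ⟨(fApp_mem_Q_iff z).1 (hz' ▸ hy), hy, hz'⟩, rfl⟩
  refine
    { nonempty := ?_
      subset := fun p hp => ⟨hp.1, hp.2.1⟩
      typeDefinable := ?_
      finite_fibers := fun x hx => Set.finite_of_ncard_ne_zero (by
        simp only [Set.mem_ofPred_eq, hfib x hx]; decide)
      finite_cofibers := fun y hy => Set.finite_of_ncard_ne_zero (by
        simp only [Set.mem_ofPred_eq, hcofib y hy]; decide)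
      k_pos := Nat.one_pos
      l_pos := Nat.two_pos
      fiber_card := hfib
      cofiber_card := hcofib }
  · obtain ⟨x, hx⟩ := Q_nonempty hU
    exact ⟨(fun _ => x, fun _ => fApp x), hx, (fApp_mem_Q_iff x).2 hx, rfl⟩
  · exact (typeDefinable_mem_Q (Sum.inl 0)).inter L15
      ((typeDefinable_mem_Q (Sum.inr 0)).inter L15 (typeDefinable_of_definable L15
        (definable_fApp_iterate_eq (Sum.inl 0) (Sum.inr 0) 1 0)))

/-- in the ultraproduct `M = ∏_𝒰 M_n` (with `𝒰` non-principal), the set `Q` is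
nonempty and type-definable over `∅`, `f(Q) = Q`, every `f`-fibre over a point of `Q` has
exactly two elements, both in `Q`; hence `{(x,y) ∈ Q × Q : f(x) = y}` is a uniform
correspondence over `∅` with `k_C = 1` and `ℓ_C = 2`, so `Q` is not measurable over `∅`. -/
theorem statement15 (𝒰 : Ultrafilter {n : ℕ // 1 ≤ n}) (hU : ∀ i, {i} ∉ 𝒰) :
    (Q 𝒰).Nonempty ∧
    TypeDefinable L15 (∅ : Set (UltraM 𝒰)) {v : Fin 1 → UltraM 𝒰 | v 0 ∈ Q 𝒰} ∧
    fApp '' Q 𝒰 = Q 𝒰 ∧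
    (∀ y ∈ Q 𝒰, {x | fApp x = y}.ncard = 2 ∧ {x | fApp x = y} ⊆ Q 𝒰) ∧
    IsUniformCorrespondence L15 (∅ : Set (UltraM 𝒰))
      {v : Fin 1 → UltraM 𝒰 | v 0 ∈ Q 𝒰} {v : Fin 1 → UltraM 𝒰 | v 0 ∈ Q 𝒰}
      {p : (Fin 1 → UltraM 𝒰) × (Fin 1 → UltraM 𝒰) |
        p.1 0 ∈ Q 𝒰 ∧ p.2 0 ∈ Q 𝒰 ∧ fApp (p.1 0) = p.2 0} 1 2 ∧
    ¬ MeasurableOver L15 (∅ : Set (UltraM 𝒰)) {v : Fin 1 → UltraM 𝒰 | v 0 ∈ Q 𝒰} := by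
  refine ⟨Q_nonempty hU, typeDefinable_mem_Q 0, fApp_image_Q, fun y hy =>
    ⟨ncard_fApp_fiber hy, ?_⟩, isUniformCorrespondence_fApp hU, fun h => ?_⟩
  · rintro x rfl
    exact (fApp_mem_Q_iff x).1 hy
  · exact absurd (h _ 1 2 (isUniformCorrespondence_fApp hU)) (by decide)

end Unimod
end

section
/- Let L be a first-order language, κ > |L| an uncountable cardinal, and M a κ-saturated L-structure. Let A ⊆ M with |A| < κ, let X and Y be sets type-definable over A, and let C be a uniform correspondence over A between X and Y. Then C is relatively definable: there exists an A-definable set D with C = D ∩ (X × Y). -/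
open FirstOrder Set

namespace Unimod

universe u v w

variable (L : FirstOrder.Language.{u, v}) {M : Type w} [L.Structure M]

/-- Compactness for `A`-definable sets in finitely many variables: in a `κ`-saturated structure
a family of sets definable over a small set has a common point as soon as every finite
subfamily does. -/
theorem Saturated.iInter_nonempty {L : FirstOrder.Language.{u, v}} {M : Type w} [L.Structure M]
    {κ : Cardinal.{w}} (hsat : Saturated L (M := M) κ) {A : Set M} (hA : Cardinal.mk A < κ)
    {α ι : Type*} [Finite α] (F : ι → Set (α → M)) (hF : ∀ i, A.Definable L (F i))
    (hfin : ∀ s : Finset ι, (⋂ i ∈ s, F i).Nonempty) : (⋂ i, F i).Nonempty := by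
  classical
  obtain ⟨N, ⟨e⟩⟩ := Finite.exists_equiv_fin α
  have hφ : ∀ i, ∃ φ : L.Formula (↥A ⊕ Fin N), ∀ v : Fin N → M,
      φ.Realize (Sum.elim (fun x => (x : M)) v) ↔ v ∘ e ∈ F i := by
    intro i
    obtain ⟨φ, hφ⟩ := Set.definable_iff_exists_formula_sum.1 (hF i)
    refine ⟨φ.relabel (Sum.map id e), fun v => ?_⟩
    rw [hφ, FirstOrder.Language.Formula.realize_relabel, Sum.elim_comp_map]
    rfl
  choose φ hφ using hφ
  obtain ⟨v, hv⟩ := hsat A hA N (Set.range φ) fun T₀ hT₀ => by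
    rw [← Set.image_univ] at hT₀
    obtain ⟨s, -, rfl⟩ := Finset.subset_set_image_iff.1 hT₀
    obtain ⟨w, hw⟩ := hfin s
    refine ⟨w ∘ e.symm, fun ψ hψ => ?_⟩
    obtain ⟨i, hi, rfl⟩ := Finset.mem_image.1 hψ
    rw [hφ, Function.comp_assoc, Equiv.symm_comp_self, Function.comp_id]
    exact Set.mem_iInter₂.1 hw i hi
  exact ⟨v ∘ e, Set.mem_iInter.2 fun i => (hφ i v).1 (hv _ ⟨i, rfl⟩)⟩

theorem definable_setOf_apply_eq (L : FirstOrder.Language.{u, v}) {M : Type w} [L.Structure M]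
    (A : Set M) {α : Type*} (a b : α) : A.Definable L {w : α → M | w a = w b} :=
  ⟨(FirstOrder.Language.Term.var a).equal (FirstOrder.Language.Term.var b), by ext; simp⟩

/-- Injectivity of a finite family of finite tuples of coordinates is a definable condition. -/
theorem definable_setOf_injective (L : FirstOrder.Language.{u, v}) {M : Type w} [L.Structure M]
    (A : Set M) {α β γ : Type*} [Finite β] [Finite γ] (f : β → γ → α) :
    A.Definable L {w : α → M | Function.Injective fun b => w ∘ f b} := by
  classical
  have := Fintype.ofFinite β
  have := Fintype.ofFinite γ
  have h : {w : α → M | Function.Injective fun b => w ∘ f b} =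
      ⋂ p ∈ (Finset.univ : Finset (β × β)).filter (fun p => p.1 ≠ p.2),
        (⋂ c ∈ (Finset.univ : Finset γ), {w : α → M | w (f p.1 c) = w (f p.2 c)})ᶜ := by
    ext w
    simp only [Set.mem_ofPred_eq, Set.mem_iInter, Finset.mem_filter, Finset.mem_univ, true_and,
      Set.mem_compl_iff, forall_true_left, Prod.forall, Function.Injective, funext_iff,
      Function.comp_apply]
    exact forall₂_congr fun a b => not_imp_not.symm
  rw [h]
  refine Set.definable_biInter_finset (fun p => Set.Definable.compl ?_) _
  exact Set.definable_biInter_finset (fun c => definable_setOf_apply_eq L A (f p.1 c) (f p.2 c)) _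

/-- In a `κ`-saturated structure (`κ > |L|` uncountable), every uniform
correspondence over a small parameter set `A` between type-definable sets `X` and `Y` is
relatively definable: it is the intersection of an `A`-definable set with `X × Y`. -/
theorem statement16 (L : FirstOrder.Language.{u, u}) (M : Type u) [L.Structure M]
    (κ : Cardinal.{u}) (hκ : Cardinal.aleph0 < κ) (hLκ : L.card < κ)
    (hsat : Saturated L (M := M) κ)
    (A : Set M) (hA : Cardinal.mk A < κ) (n m : ℕ)
    (X : Set (Fin n → M)) (Y : Set (Fin m → M))
    (hX : TypeDefinable L A X) (hY : TypeDefinable L A Y)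
    (C : Set ((Fin n → M) × (Fin m → M))) (k ℓ : ℕ)
    (hC : IsUniformCorrespondence L A X Y C k ℓ) :
    ∃ D : Set ((Fin n ⊕ Fin m) → M), A.Definable L D ∧
      pairSet C = D ∩ pairSet (X ×ˢ Y) := by
  classical
  obtain ⟨S, hS, hCS⟩ := hC.typeDefinable
  have mem_C (x : Fin n → M) (y : Fin m → M) : (x, y) ∈ C ↔ ∀ t ∈ S, Sum.elim x y ∈ t := by
    rw [← Set.mem_sInter, ← hCS]
    rfl
  let pr (i : Fin (k + 1)) : Fin n ⊕ Fin m → Fin n ⊕ Fin (k + 1) × Fin m := Sum.map id (Prod.mk i)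
  let F (t : ↥(insert Set.univ S)) : Set (Fin n ⊕ Fin (k + 1) × Fin m → M) :=
    {w | Function.Injective fun i => w ∘ fun j => Sum.inr (i, j)} ∩
      ⋂ i ∈ (Finset.univ : Finset (Fin (k + 1))), (fun w => w ∘ pr i) ⁻¹' (t : Set _)
  have hF (t) : A.Definable L (F t) := by
    refine (definable_setOf_injective L A fun i j => Sum.inr (i, j)).inter
      (Set.definable_biInter_finset (fun i => Set.Definable.preimage_comp _ ?_) _)
    obtain ⟨t, rfl | ht⟩ := t
    · exact Set.definable_univ
    · exact hS t ht
  have mem_F (t) (w) : w ∈ F t ↔ (Function.Injective fun i => w ∘ fun j => Sum.inr (i, j)) ∧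
      ∀ i, w ∘ pr i ∈ (t : Set _) := by
    simp [F]
  have hempty : ¬ (⋂ t, F t).Nonempty := by
    rintro ⟨w, hw⟩
    simp only [Set.mem_iInter, mem_F] at hw
    have hwC (i) : (w ∘ Sum.inl, w ∘ fun j => Sum.inr (i, j)) ∈ C := by
      rw [mem_C]
      intro t ht
      convert (hw ⟨t, Or.inr ht⟩).2 i using 1
      ext (a | a) <;> rfl
    have hx := (hC.subset (hwC 0)).1
    have hsub : (Set.range fun i => w ∘ fun j => Sum.inr (i, j)) ⊆ {y | (w ∘ Sum.inl, y) ∈ C} :=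
      Set.range_subset_iff.2 hwC
    have hcard := Set.ncard_le_ncard hsub (hC.finite_fibers _ hx)
    rw [hC.fiber_card _ hx, ← Set.image_univ,
      Set.ncard_image_of_injective _ (hw ⟨_, Or.inl rfl⟩).1, Set.ncard_univ, Nat.card_fin] at hcard
    omega
  obtain ⟨s, hs⟩ := not_forall.1 fun h => hempty (hsat.iInter_nonempty hA F hF h)
  refine ⟨⋂ t ∈ s, (t : Set _), Set.definable_biInter_finset (fun t => ?_) _, ?_⟩
  · obtain ⟨t, rfl | ht⟩ := t
    · exact Set.definable_univ
    · exact hS t ht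
  have sub_D {x : Fin n → M} {y : Fin m → M} (h : (x, y) ∈ C) :
      Sum.elim x y ∈ ⋂ t ∈ s, (t : Set (Fin n ⊕ Fin m → M)) := by
    refine Set.mem_iInter₂.2 fun t _ => ?_
    obtain ⟨t, rfl | ht⟩ := t
    · trivial
    · exact (mem_C x y).1 h t ht
  ext v
  obtain ⟨⟨x, y⟩, rfl⟩ := (Equiv.sumArrowEquivProdArrow (Fin n) (Fin m) M).symm.surjective v
  change (x, y) ∈ C ↔ Sum.elim x y ∈ (⋂ t ∈ s, (t : Set (Fin n ⊕ Fin m → M))) ∧ (x, y) ∈ X ×ˢ Y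
  refine ⟨fun h => ⟨sub_D h, hC.subset h⟩, fun ⟨hD, hx, _⟩ => by_contra fun hxy => hs ?_⟩
  have hfinite := hC.finite_fibers x hx
  have hy : y ∉ {y | (x, y) ∈ C} := hxy
  have hcard : Nat.card ↥(insert y {y | (x, y) ∈ C}) = k + 1 := by
    rw [Nat.card_coe_set_eq, Set.ncard_insert_of_notMem hy hfinite, hC.fiber_card x hx]
  have := (hfinite.insert y).to_subtype
  let e := (Finite.equivFinOfCardEq hcard).symm
  refine ⟨Sum.elim x fun p => (e p.1 : Fin m → M) p.2, Set.mem_iInter₂.2 fun t ht => ?_⟩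
  refine (mem_F t _).2 ⟨fun i j hij => e.injective (Subtype.ext hij), fun i => ?_⟩
  have he : Sum.elim x (e i : Fin m → M) ∈ ⋂ t ∈ s, (t : Set (Fin n ⊕ Fin m → M)) := by
    obtain h | h := (e i).2
    · rwa [h]
    · exact sub_D h
  convert Set.mem_iInter₂.1 he t ht using 1
  ext (a | a) <;> rfl

end Unimod
end
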